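/- arXiv:1908.03903 — 4 statements merged into one kernel-verified Lean document; each statement's English description precedes it below -/
import Mathlib

section
/- The map T is a linear isometry, T*ST = D, and W is unitary. Moreover, suppose v ∈ L²(Ω, μ) satisfies Dv = λv for some real λ with |λ| ≤ 1, and set μ₊ := λ + i√(1 − λ²) and μ₋ := λ − i√(1 − λ²). Then W((I − μ₊ S) T v) = μ₊ · (I − μ₊ S) T v and W((I − μ₋ S) T v) = μ₋ · (I − μ₋ S) T v; in particular, whenever (I − μ₊ S)Tv ≠ 0 (respectively (I − μ₋ S)Tv ≠ 0) it is an eigenvector of W with eigenvalue μ₊ (respectively μ₋). -/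
open MeasureTheory ContinuousLinearMap

/-- With `(Tf)(x,y) = √(p(x,y)) f(x)`, `(Sg)(x,y) = g(y,x)`,
`(Dg)(x) = ∫ √(p(x,y)p(y,x)) g(y) dμ(y)` and `W = S (2TT* − I)`: `T` is a linear isometry,
`T*ST = D`, and `W` is unitary. Moreover, if `Dv = λv` with `λ` real, `|λ| ≤ 1`, and
`μ± = λ ± i√(1−λ²)`, then `W((I − μ± S) T v) = μ± (I − μ± S) T v`; in particular, whenever
`(I − μ± S)Tv ≠ 0` it is an eigenvector of `W` with eigenvalue `μ±`. -/
theorem quantum_walk_spectrum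
    {Ω : Type*} [MeasurableSpace Ω] (μ : Measure Ω) [SigmaFinite μ]
    (p : Ω → Ω → ℝ) (hp_meas : Measurable (Function.uncurry p))
    (hp_nonneg : ∀ x y, 0 ≤ p x y)
    (hp_int : ∀ᵐ x ∂μ, ∫ y, p x y ∂μ = 1)
    (T : Lp ℂ 2 μ →L[ℂ] Lp ℂ 2 (μ.prod μ))
    (hT : ∀ f : Lp ℂ 2 μ,
      (T f : Ω × Ω → ℂ) =ᵐ[μ.prod μ] fun z => (Real.sqrt (p z.1 z.2) : ℂ) * f z.1)
    (S : Lp ℂ 2 (μ.prod μ) →L[ℂ] Lp ℂ 2 (μ.prod μ))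
    (hS : ∀ g : Lp ℂ 2 (μ.prod μ),
      (S g : Ω × Ω → ℂ) =ᵐ[μ.prod μ] fun z => g (z.2, z.1))
    (D : Lp ℂ 2 μ →L[ℂ] Lp ℂ 2 μ)
    (hD : ∀ g : Lp ℂ 2 μ,
      (D g : Ω → ℂ) =ᵐ[μ] fun x => ∫ y, (Real.sqrt (p x y * p y x) : ℂ) * g y ∂μ)
    (W : Lp ℂ 2 (μ.prod μ) →L[ℂ] Lp ℂ 2 (μ.prod μ))
    (hW : W = S ∘L ((2 : ℂ) • (T ∘L adjoint T) - 1)) :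
    (∀ f : Lp ℂ 2 μ, ‖T f‖ = ‖f‖) ∧
    ((adjoint T ∘L S) ∘L T = D) ∧
    ((∀ g, ‖W g‖ = ‖g‖) ∧ Function.Surjective W) ∧
    (∀ (v : Lp ℂ 2 μ) (lam : ℝ), |lam| ≤ 1 → D v = (lam : ℂ) • v →
      (W ((1 - ((lam : ℂ) + Complex.I * (Real.sqrt (1 - lam ^ 2) : ℂ)) • S) (T v))
          = ((lam : ℂ) + Complex.I * (Real.sqrt (1 - lam ^ 2) : ℂ)) •
            ((1 - ((lam : ℂ) + Complex.I * (Real.sqrt (1 - lam ^ 2) : ℂ)) • S) (T v))) ∧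
      (W ((1 - ((lam : ℂ) - Complex.I * (Real.sqrt (1 - lam ^ 2) : ℂ)) • S) (T v))
          = ((lam : ℂ) - Complex.I * (Real.sqrt (1 - lam ^ 2) : ℂ)) •
            ((1 - ((lam : ℂ) - Complex.I * (Real.sqrt (1 - lam ^ 2) : ℂ)) • S) (T v)))) := by
  have hswap : MeasurePreserving (Prod.swap : Ω × Ω → Ω × Ω) (μ.prod μ) (μ.prod μ) :=
    Measure.measurePreserving_swap
  have hTT : ∀ f g : Lp ℂ 2 μ, inner ℂ (T f) (T g) = inner ℂ f g := by
    intro f g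
    have hi : Integrable (fun z => inner ℂ (T f z) (T g z)) (μ.prod μ) :=
      L2.integrable_inner (𝕜 := ℂ) (T f) (T g)
    have he : (fun z => inner ℂ (T f z) (T g z)) =ᵐ[μ.prod μ]
        fun z => (p z.1 z.2 : ℂ) * inner ℂ (f z.1) (g z.1) := by
      filter_upwards [hT f, hT g] with z h1 h2
      rw [h1, h2]
      have h3 : ((Real.sqrt (p z.1 z.2) : ℝ) : ℂ) * ((Real.sqrt (p z.1 z.2) : ℝ) : ℂ)
          = (p z.1 z.2 : ℂ) := by
        rw [← Complex.ofReal_mul, Real.mul_self_sqrt (hp_nonneg _ _)]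
      rw [← h3]
      simp only [RCLike.inner_apply, map_mul, Complex.conj_ofReal]
      ring
    rw [L2.inner_def, L2.inner_def, integral_congr_ae he, integral_prod _ (hi.congr he)]
    apply integral_congr_ae
    filter_upwards [hp_int] with x hx
    rw [integral_mul_const, integral_complex_ofReal, hx]
    simp
  have hSS : ∀ g, S (S g) = g := by
    intro g
    apply Lp.ext
    have h := hswap.quasiMeasurePreserving.ae (hS g)
    filter_upwards [hS (S g), h] with z h1 h2
    rw [h1]
    exact h2
  have hSin : ∀ f g, inner ℂ (S f) (S g) = inner ℂ f g := by
    intro f g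
    rw [L2.inner_def, L2.inner_def]
    rw [← hswap.integral_comp MeasurableEquiv.prodComm.measurableEmbedding
      (fun z => inner ℂ (f z) (g z))]
    apply integral_congr_ae
    filter_upwards [hS f, hS g] with z h1 h2
    rw [h1, h2]
    rfl
  have hSn : ∀ g, ‖S g‖ = ‖g‖ := by
    intro g
    rw [@norm_eq_sqrt_re_inner ℂ, @norm_eq_sqrt_re_inner ℂ _ _ _ _ g, hSin]
  have hTn : ∀ g, ‖T g‖ = ‖g‖ := by
    intro g
    rw [@norm_eq_sqrt_re_inner ℂ, @norm_eq_sqrt_re_inner ℂ _ _ _ _ g, hTT]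
  have hTa : ∀ f, adjoint T (T f) = f := by
    intro f
    apply ext_inner_left ℂ
    intro g
    rw [adjoint_inner_right, hTT]
  have hTSTD : ∀ g, adjoint T (S (T g)) = D g := by
    intro g
    apply ext_inner_left ℂ
    intro f
    rw [adjoint_inner_right]
    have hi : Integrable (fun z => inner ℂ (T f z) (S (T g) z)) (μ.prod μ) :=
      L2.integrable_inner (𝕜 := ℂ) (T f) (S (T g))
    have he : (fun z => inner ℂ (T f z) (S (T g) z)) =ᵐ[μ.prod μ]
        fun z => ((Real.sqrt (p z.1 z.2 * p z.2 z.1) : ℂ) * g z.2) *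
          (starRingEnd ℂ) (f z.1) := by
      filter_upwards [hT f, hS (T g), hswap.quasiMeasurePreserving.ae (hT g)] with z h1 h2 h3
      have h4 : (T g) (z.2, z.1) = (Real.sqrt (p z.2 z.1) : ℂ) * g z.2 := h3
      rw [h1, h2, h4, Real.sqrt_mul (hp_nonneg _ _)]
      simp only [RCLike.inner_apply, map_mul, Complex.conj_ofReal, Complex.ofReal_mul]
      ring
    rw [L2.inner_def, L2.inner_def, integral_congr_ae he, integral_prod _ (hi.congr he)]
    apply integral_congr_ae
    filter_upwards [hD g] with x hx
    rw [integral_mul_const, hx]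
    simp only [RCLike.inner_apply]
  have hWa : ∀ g, W g = S ((2 : ℂ) • T (adjoint T g) - g) := by
    intro g
    rw [hW]
    rfl
  refine ⟨hTn, ContinuousLinearMap.ext hTSTD, ⟨?_, ?_⟩, ?_⟩
  · intro g
    rw [hWa, hSn, @norm_eq_sqrt_re_inner ℂ, @norm_eq_sqrt_re_inner ℂ _ _ _ _ g]
    congr 2
    have h1 : inner ℂ (T (adjoint T g)) g = inner ℂ (adjoint T g) (adjoint T g) := by
      rw [adjoint_inner_right]
    have h2 : inner ℂ g (T (adjoint T g)) = inner ℂ (adjoint T g) (adjoint T g) := by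
      rw [← adjoint_inner_left]
    simp only [inner_sub_left, inner_sub_right, inner_smul_left, inner_smul_right, h1, h2, hTT]
    simp only [map_ofNat]
    ring
  · intro g
    refine ⟨(2 : ℂ) • T (adjoint T (S g)) - S g, ?_⟩
    rw [hWa]
    simp only [map_sub, map_smul, hTa, hSS]
    module
  · intro v lam hl hv
    have key : ∀ m : ℂ, m ^ 2 = 2 * lam * m - 1 →
        W ((1 - m • S) (T v)) = m • ((1 - m • S) (T v)) := by
      intro m hm
      have e : (1 - m • S) (T v) = T v - m • S (T v) := rfl
      rw [e, hWa]
      simp only [map_sub, map_smul, hTa, hSS, hTSTD, hv]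
      have hm' : m * m = 2 * lam * m - 1 := by rw [← hm]; ring
      rw [smul_sub m, smul_smul m m, hm']
      module
    have hs : ((Real.sqrt (1 - lam ^ 2) : ℝ) : ℂ) ^ 2 = 1 - (lam : ℂ) ^ 2 := by
      rw [← Complex.ofReal_pow, Real.sq_sqrt (by nlinarith [abs_le.mp hl])]
      push_cast
      rfl
    constructor
    · apply key
      linear_combination (Complex.I ^ 2) * hs + (1 - (lam : ℂ) ^ 2) * Complex.I_sq
    · apply key
      linear_combination (Complex.I ^ 2) * hs + (1 - (lam : ℂ) ^ 2) * Complex.I_sq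
end

section
/- For all a, b > 0: (∫_{K'} e^{−((a+b)/2)·x₀} dx) / √(Z(a) Z(b)) ≥ (2√(ab)/(a+b))^{n+1}. -/
open MeasureTheory

lemma bm_compact (A B C : Set ℝ) (hA : IsCompact A) (hB : IsCompact B)
    (hA0 : A.Nonempty) (hB0 : B.Nonempty)
    (h : ∀ x ∈ A, ∀ y ∈ B, x + y ∈ C) : volume A + volume B ≤ volume C := by
  obtain ⟨a, ha⟩ := hA.exists_isGreatest hA0
  obtain ⟨b, hb⟩ := hB.exists_isLeast hB0
  have e1 : volume ((fun x => x + (-b)) ⁻¹' A) = volume A := measure_preimage_add_right _ _ _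
  have e2 : volume ((fun x => x + (-a)) ⁻¹' B) = volume B := measure_preimage_add_right _ _ _
  have hm : MeasurableSet ((fun x => x + (-a)) ⁻¹' B) :=
    (measurable_id.add_const _) hB.measurableSet
  have hi : volume (((fun x => x + (-b)) ⁻¹' A) ∩ ((fun x => x + (-a)) ⁻¹' B)) = 0 := by
    refine measure_mono_null (t := {a + b}) ?_ (by simp)
    rintro x ⟨h1, h2⟩
    have := ha.2 h1
    have := hb.2 h2
    simp only [Set.mem_singleton_iff]
    simp only at *
    linarith
  have := measure_union_add_inter (μ := volume) ((fun x => x + (-b)) ⁻¹' A) hm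
  rw [hi, e1, e2, add_zero] at this
  rw [← this]
  apply measure_mono
  rintro x (h1 | h1)
  · have := h _ h1 _ hb.1
    simpa using this
  · have := h _ ha.1 _ h1
    simpa using this

lemma bm_meas (A B C : Set ℝ) (hA : MeasurableSet A) (hB : MeasurableSet B)
    (hA0 : A.Nonempty) (hB0 : B.Nonempty)
    (h : ∀ x ∈ A, ∀ y ∈ B, x + y ∈ C) : volume A + volume B ≤ volume C := by
  obtain ⟨a, ha⟩ := hA0
  obtain ⟨b, hb⟩ := hB0
  rw [hA.measure_eq_iSup_isCompact, hB.measure_eq_iSup_isCompact]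
  simp only [iSup_and']
  refine ENNReal.biSup_add_biSup_le' (p := fun K => K ⊆ A ∧ IsCompact K)
    (q := fun K => K ⊆ B ∧ IsCompact K)
    ⟨∅, by simp⟩ ⟨∅, by simp⟩ ?_
  rintro K ⟨hK, hKc⟩ L ⟨hL, hLc⟩
  refine le_trans (add_le_add (measure_mono (Set.subset_insert a K))
    (measure_mono (Set.subset_insert b L))) ?_
  refine bm_compact _ _ _ (hKc.insert a) (hLc.insert b) (Set.insert_nonempty _ _)
    (Set.insert_nonempty _ _) ?_
  intro x hx y hy
  exact h x (Set.insert_subset ha hK hx) y (Set.insert_subset hb hL hy)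

lemma bm_half (A B C : Set ℝ) (hA : MeasurableSet A) (hB : MeasurableSet B)
    (hA0 : A.Nonempty) (hB0 : B.Nonempty)
    (h : ∀ x ∈ A, ∀ y ∈ B, (1/2 : ℝ) * (x + y) ∈ C) :
    volume A + volume B ≤ 2 * volume C := by
  have e := Real.volume_preimage_mul_left (a := 1/2) (by norm_num) C
  have : ENNReal.ofReal |(1/2 : ℝ)⁻¹| = 2 := by norm_num
  rw [this] at e
  rw [← e]
  exact bm_meas A B _ hA hB hA0 hB0 h

lemma pl_core (f g h : ℝ → ℝ) (hf : Measurable f) (hg : Measurable g) (hh : Measurable h)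
    (f0 : ∀ x, 0 ≤ f x) (g0 : ∀ x, 0 ≤ g x) (h0 : ∀ x, 0 ≤ h x)
    (f1 : ∀ x, f x ≤ 1) (g1 : ∀ x, g x ≤ 1)
    (fs : ∀ t < 1, ∃ x, t < f x) (gs : ∀ t < 1, ∃ x, t < g x)
    (H : ∀ x y, f x * g y ≤ h ((1/2 : ℝ) * (x + y)) ^ 2) :
    (∫⁻ x, ENNReal.ofReal (f x)) + ∫⁻ x, ENNReal.ofReal (g x)
      ≤ 2 * ∫⁻ x, ENNReal.ofReal (h x) := by
  rw [lintegral_eq_lintegral_meas_lt _ (.of_forall f0) hf.aemeasurable,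
    lintegral_eq_lintegral_meas_lt _ (.of_forall g0) hg.aemeasurable,
    lintegral_eq_lintegral_meas_lt _ (.of_forall h0) hh.aemeasurable]
  have anti : ∀ k : ℝ → ℝ, Measurable (fun t => volume {a | t < k a}) := by
    intro k
    refine Antitone.measurable ?_
    intro s t hst
    exact measure_mono fun x hx => lt_of_le_of_lt hst hx
  rw [← lintegral_add_left (anti f), ← lintegral_const_mul _ (anti h)]
  refine setLIntegral_mono' measurableSet_Ioi ?_
  intro t ht
  have ht : 0 < t := ht
  rcases lt_or_ge t 1 with h1 | h1
  · refine bm_half _ _ _ (measurableSet_lt measurable_const hf)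
      (measurableSet_lt measurable_const hg) (fs t h1) (gs t h1) ?_
    intro x hx y hy
    have hx : t < f x := hx
    have hy : t < g y := hy
    show t < h _
    have := H x y
    refine lt_of_pow_lt_pow_left₀ 2 (h0 _) ?_
    nlinarith
  · have e1 : {a | t < f a} = ∅ := by
      ext x; simpa using (f1 x).trans h1
    have e2 : {a | t < g a} = ∅ := by
      ext x; simpa using (g1 x).trans h1
    simp [e1, e2]

lemma amgm (A B C : ENNReal) (h : A + B ≤ 2 * C) : A * B ≤ C ^ 2 := by
  by_cases hC : C = ⊤
  · simp [hC]
  have h2 : A + B ≠ ⊤ := ne_top_of_le_ne_top (ENNReal.mul_ne_top (by simp) hC) h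
  have hA : A ≠ ⊤ := fun h => h2 (by simp [h])
  have hB : B ≠ ⊤ := fun h => h2 (by simp [h])
  lift A to NNReal using hA
  lift B to NNReal using hB
  lift C to NNReal using hC
  norm_cast at *
  have : (A : ℝ) + B ≤ 2 * C := by exact_mod_cast h
  have : (A : ℝ) * B ≤ C ^ 2 := by
    have := A.2; have := B.2; have := C.2
    nlinarith [sq_nonneg ((A : ℝ) - B), NNReal.coe_nonneg A, NNReal.coe_nonneg B,
      NNReal.coe_nonneg C]
  exact_mod_cast this

lemma norm_aux (f : ℝ → ENNReal) (hf : Measurable f) (M : ENNReal) (hM : M = ⨆ x, f x)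
    (M0 : M ≠ 0) (Mt : M ≠ ⊤) :
    (∀ x, f x / M ≤ 1) ∧ (∀ t < 1, ∃ x, t < (f x / M).toReal) ∧
      ∫⁻ x, f x = M * ∫⁻ x, ENNReal.ofReal (f x / M).toReal := by
  have h1 : ∀ x, f x / M ≤ 1 := by
    intro x
    apply ENNReal.div_le_of_le_mul
    rw [one_mul, hM]
    exact le_iSup f x
  have ht : ∀ x, f x / M ≠ ⊤ := fun x => ne_top_of_le_ne_top (by simp) (h1 x)
  refine ⟨h1, ?_, ?_⟩
  · intro t h
    by_contra! hc
    have t0 : 0 ≤ t := ENNReal.toReal_nonneg.trans (hc 0)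
    have : M ≤ ENNReal.ofReal t * M := by
      conv_lhs => rw [hM]
      refine iSup_le fun x => ?_
      have := (ENNReal.le_ofReal_iff_toReal_le (ht x) t0).2 (hc x)
      exact (ENNReal.div_le_iff M0 Mt).1 this
    have h2 : ENNReal.ofReal t * M < 1 * M :=
      (ENNReal.mul_lt_mul_iff_left M0 Mt).2 (by simpa using h)
    rw [one_mul] at h2
    exact absurd this (not_le.2 h2)
  · rw [← lintegral_const_mul]
    · refine lintegral_congr fun x => ?_
      rw [ENNReal.ofReal_toReal (ht x), ENNReal.mul_div_cancel M0 Mt]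
    · simp only [ENNReal.ofReal_toReal (ht _)]
      exact hf.div_const M

lemma pl_bdd (f g h : ℝ → ENNReal) (hf : Measurable f) (hg : Measurable g) (hh : Measurable h)
    (ft : ⨆ x, f x ≠ ⊤) (gt : ⨆ x, g x ≠ ⊤)
    (H : ∀ x y, f x * g y ≤ h ((1/2 : ℝ) * (x + y)) ^ 2) :
    (∫⁻ x, f x) * ∫⁻ x, g x ≤ (∫⁻ x, h x) ^ 2 := by
  by_cases f0 : ⨆ x, f x = 0
  · have : ∀ x, f x = 0 := by simpa using f0
    simp [this]
  by_cases g0 : ⨆ x, g x = 0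
  · have : ∀ x, g x = 0 := by simpa using g0
    simp [this]
  generalize hM : ⨆ x, f x = M at *
  generalize hN : ⨆ x, g x = N at *
  obtain ⟨f1, fs, fi⟩ := norm_aux f hf M hM.symm f0 ft
  obtain ⟨g1, gs, gi⟩ := norm_aux g hg N hN.symm g0 gt
  obtain ⟨r, hr, r0, rt⟩ : ∃ r : ENNReal, r ^ 2 = M * N ∧ r ≠ 0 ∧ r ≠ ⊤ := by
    have e : ((M * N) ^ (1/2 : ℝ)) ^ 2 = M * N := by
      rw [← ENNReal.rpow_natCast, ← ENNReal.rpow_mul]; norm_num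
    refine ⟨(M * N) ^ (1/2 : ℝ), e, ?_, ?_⟩
    · intro h; rw [h] at e; simp at e; tauto
    · exact ENNReal.rpow_ne_top_of_nonneg (by norm_num) (ENNReal.mul_ne_top ft gt)
  have ht : ∀ x, min (h x / r) 1 ≠ ⊤ := fun x => ne_top_of_le_ne_top (by simp) (min_le_right _ _)
  have key := pl_core (fun x => (f x / M).toReal) (fun x => (g x / N).toReal)
    (fun x => (min (h x / r) 1).toReal) (hf.div_const M).ennreal_toReal
    (hg.div_const N).ennreal_toReal ((hh.div_const r).min measurable_const).ennreal_toReal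
    (fun _ => ENNReal.toReal_nonneg) (fun _ => ENNReal.toReal_nonneg)
    (fun _ => ENNReal.toReal_nonneg)
    (fun x => ENNReal.toReal_le_of_le_ofReal (by simp) (by simpa using f1 x))
    (fun x => ENNReal.toReal_le_of_le_ofReal (by simp) (by simpa using g1 x))
    fs gs (by
      intro x y
      rw [← ENNReal.toReal_mul, ← ENNReal.toReal_pow]
      refine ENNReal.toReal_mono (ENNReal.pow_ne_top (ht _)) ?_
      rcases min_cases (h (1/2 * (x+y)) / r) 1 with ⟨e, _⟩ | ⟨e, _⟩
      · rw [e]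
        have : f x / M * (g y / N) = f x * g y / r ^ 2 := by
          rw [hr]; simp only [div_eq_mul_inv]
          rw [ENNReal.mul_inv (Or.inl f0) (Or.inl ft)]; ring
        have e2 : ∀ u : ENNReal, (u / r) ^ 2 = u ^ 2 / r ^ 2 := by
          intro u
          rw [div_eq_mul_inv, mul_pow, ← ENNReal.inv_pow, ← div_eq_mul_inv]
        rw [this, e2]
        exact ENNReal.div_le_div_right (H x y) _
      · rw [e, one_pow]
        exact mul_le_one' (f1 x) (g1 y))
  have key2 := amgm _ _ _ key
  have hi : r * ∫⁻ x, ENNReal.ofReal (min (h x / r) 1).toReal ≤ ∫⁻ x, h x := by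
    simp only [ENNReal.ofReal_toReal (ht _)]
    rw [← lintegral_const_mul _ ((hh.div_const r).min measurable_const)]
    refine lintegral_mono fun x => ?_
    calc r * min (h x / r) 1 ≤ r * (h x / r) := by gcongr; exact min_le_left _ _
      _ = h x := ENNReal.mul_div_cancel r0 rt
  rw [fi, gi]
  refine le_trans ?_ (pow_le_pow_left' hi 2)
  rw [mul_pow, hr, mul_mul_mul_comm]
  gcongr

lemma trunc (f : ℝ → ENNReal) (hf : Measurable f) :
    ∫⁻ x, f x = ⨆ k : ℕ, ∫⁻ x, min (f x) k := by
  rw [← lintegral_iSup]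
  · refine lintegral_congr fun x => ?_
    rw [← inf_iSup_eq, ENNReal.iSup_natCast]; simp
  · intro k; exact hf.min measurable_const
  · intro i j hij x
    exact min_le_min le_rfl (by exact_mod_cast hij)

lemma pl_one (f g h : ℝ → ENNReal) (hf : Measurable f) (hg : Measurable g) (hh : Measurable h)
    (H : ∀ x y, f x * g y ≤ h ((1/2 : ℝ) * (x + y)) ^ 2) :
    (∫⁻ x, f x) * ∫⁻ x, g x ≤ (∫⁻ x, h x) ^ 2 := by
  rw [trunc f hf, trunc g hg, ENNReal.iSup_mul]
  refine iSup_le fun i => ?_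
  rw [ENNReal.mul_iSup]
  refine iSup_le fun j => ?_
  have b : ∀ (f : ℝ → ENNReal) (k : ℕ), ⨆ x, min (f x) (k : ENNReal) ≠ ⊤ := fun f k =>
    ne_top_of_le_ne_top (ENNReal.natCast_ne_top k) (iSup_le fun x => min_le_right _ _)
  refine pl_bdd _ _ h (hf.min measurable_const) (hg.min measurable_const) hh (b f i) (b g j) ?_
  intro x y
  exact (mul_le_mul' (min_le_left _ _) (min_le_left _ _)).trans (H x y)

lemma lint_succ (n : ℕ) (f : (Fin (n+1) → ℝ) → ENNReal) (hf : Measurable f) :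
    ∫⁻ x, f x = ∫⁻ s : ℝ, ∫⁻ y : Fin n → ℝ, f (Fin.cons s y) := by
  have mp := (volume_preserving_piFinSuccAbove (fun _ : Fin (n+1) => ℝ) 0).symm
  have hm : Measurable fun z : ℝ × (Fin n → ℝ) =>
      f ((MeasurableEquiv.piFinSuccAbove (fun _ : Fin (n+1) => ℝ) 0).symm z) :=
    hf.comp (MeasurableEquiv.measurable _)
  rw [← mp.lintegral_comp hf]
  erw [lintegral_prod _ hm.aemeasurable]
  refine lintegral_congr fun s => lintegral_congr fun y => ?_
  congr 1
  simp [MeasurableEquiv.piFinSuccAbove, Fin.insertNthEquiv]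

lemma pl_all (n : ℕ) : ∀ (f g h : (Fin n → ℝ) → ENNReal), Measurable f → Measurable g →
    Measurable h → (∀ x y, f x * g y ≤ h ((1/2 : ℝ) • (x + y)) ^ 2) →
    (∫⁻ x, f x) * ∫⁻ x, g x ≤ (∫⁻ x, h x) ^ 2 := by
  induction n with
  | zero =>
    intro f g h _ _ _ H
    have := H default default
    rw [lintegral_unique, lintegral_unique, lintegral_unique]
    have e : (volume : Measure (Fin 0 → ℝ)) Set.univ = 1 := by simp [volume_pi]
    rw [e, mul_one, mul_one, mul_one]
    convert this
  | succ n ih =>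
    intro f g h hf hg hh H
    have hc : Measurable fun z : ℝ × (Fin n → ℝ) => (Fin.cons z.1 z.2 : Fin (n+1) → ℝ) := by
      refine measurable_pi_lambda _ fun i => ?_
      refine Fin.cases ?_ (fun j => ?_) i
      · simpa using measurable_fst
      · simpa [Function.comp_def] using (measurable_pi_apply j).comp (measurable_snd (α := ℝ) (β := Fin n → ℝ))
    have hs : ∀ s : ℝ, Measurable fun y : Fin n → ℝ => (Fin.cons s y : Fin (n+1) → ℝ) :=
      fun s => hc.comp (measurable_const.prodMk measurable_id)
    rw [lint_succ n f hf, lint_succ n g hg, lint_succ n h hh]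
    refine pl_one _ _ _ (hf.comp hc).lintegral_prod_right' (hg.comp hc).lintegral_prod_right'
      (hh.comp hc).lintegral_prod_right' ?_
    intro s t
    refine ih _ _ _ (hf.comp (hs _)) (hg.comp (hs _)) (hh.comp (hs _)) ?_
    intro x y
    refine (H _ _).trans (le_of_eq ?_)
    congr 2
    ext i
    refine Fin.cases ?_ (fun j => ?_) i <;> simp [mul_add]

/-- For a convex body `K' ⊆ ℝ^{n+1}` with `Z(c) := ∫_{K'} e^{-c x₀} dx`,
for all `a, b > 0`:
`(∫_{K'} e^{-((a+b)/2) x₀} dx)/√(Z(a) Z(b)) ≥ (2√(ab)/(a+b))^{n+1}`. -/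
theorem inner_product_lower_bound_logconcavity
    (n : ℕ) (hn : 1 ≤ n) (K' : Set (Fin (n + 1) → ℝ))
    (hK_compact : IsCompact K') (hK_convex : Convex ℝ K')
    (hK_interior : (interior K').Nonempty)
    (Z : ℝ → ℝ) (hZ : ∀ c, Z c = ∫ x in K', Real.exp (-(c * x 0)))
    (a b : ℝ) (ha : 0 < a) (hb : 0 < b) :
    (2 * Real.sqrt (a * b) / (a + b)) ^ (n + 1)
      ≤ (∫ x in K', Real.exp (-(((a + b) / 2) * x 0))) / Real.sqrt (Z a * Z b) := by
  have hKm := hK_compact.measurableSet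
  have hcont : ∀ c : ℝ, Continuous fun x : Fin (n+1) → ℝ => Real.exp (-(c * x 0)) := by
    intro c; fun_prop
  have hint : ∀ c : ℝ, IntegrableOn (fun x : Fin (n+1) → ℝ => Real.exp (-(c * x 0))) K' :=
    fun c => (hcont c).continuousOn.integrableOn_compact hK_compact
  have hpos : ∀ c, 0 < Z c := by
    intro c
    rw [hZ, setIntegral_pos_iff_support_of_nonneg_ae
      (.of_forall fun x => (Real.exp_pos _).le) (hint c)]
    have : (Function.support fun x : Fin (n+1) → ℝ => Real.exp (-(c * x 0))) = Set.univ := by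
      ext x; simp [Real.exp_ne_zero]
    rw [this, Set.univ_inter]
    exact Measure.measure_pos_of_nonempty_interior _ hK_interior
  rw [← hZ]
  set F : ℝ → (Fin (n+1) → ℝ) → ℝ := fun c =>
    K'.indicator fun x => Real.exp (-(c * x 0)) with hF
  have F0 : ∀ c x, 0 ≤ F c x := fun c x => Set.indicator_nonneg (fun _ _ => (Real.exp_pos _).le) x
  have Fm : ∀ c, Measurable (F c) := fun c => (hcont c).measurable.indicator hKm
  have Fi : ∀ c, Integrable (F c) := fun c => (integrable_indicator_iff hKm).2 (hint c)
  have FZ : ∀ c, ∫ x, F c x = Z c := fun c => by rw [hZ, ← integral_indicator hKm]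
  have FL : ∀ c, 0 < c → ∫⁻ x, ENNReal.ofReal (F c (c⁻¹ • x)) =
      ENNReal.ofReal (c ^ (n+1) * Z c) := by
    intro c hc
    rw [← ofReal_integral_eq_lintegral_ofReal
      ((integrable_comp_smul_iff volume (F c) (inv_ne_zero hc.ne')).2 (Fi c))
      (.of_forall fun x => F0 _ _), Measure.integral_comp_inv_smul, FZ]
    simp [abs_of_pos hc]
  have hm : 0 < (a + b) / 2 := by positivity
  have Lm : ∀ c, Measurable fun x => ENNReal.ofReal (F c (c⁻¹ • x)) := fun c =>
    ((Fm c).comp (measurable_const_smul _)).ennreal_ofReal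
  have key := pl_all (n+1) _ _ _ (Lm a) (Lm b) (Lm ((a+b)/2)) (by
    intro x y
    rw [← ENNReal.ofReal_mul (F0 _ _), ← ENNReal.ofReal_pow (F0 _ _)]
    refine ENNReal.ofReal_le_ofReal ?_
    by_cases hx : a⁻¹ • x ∈ K'
    swap
    · have : F a (a⁻¹ • x) = 0 := Set.indicator_of_notMem hx _
      rw [this, zero_mul]; positivity
    by_cases hy : b⁻¹ • y ∈ K'
    swap
    · have : F b (b⁻¹ • y) = 0 := Set.indicator_of_notMem hy _
      rw [this, mul_zero]; positivity
    have hz : ((a+b)/2)⁻¹ • (1/2 : ℝ) • (x + y) ∈ K' := by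
      have := hK_convex hx hy (a := a/(a+b)) (b := b/(a+b)) (by positivity) (by positivity)
        (by field_simp)
      convert this using 1
      ext i
      simp
      field_simp
    have e1 : F a (a⁻¹ • x) = _ := Set.indicator_of_mem hx _
    have e2 : F b (b⁻¹ • y) = _ := Set.indicator_of_mem hy _
    have e3 : F ((a+b)/2) (((a+b)/2)⁻¹ • (1/2 : ℝ) • (x + y)) = _ := Set.indicator_of_mem hz _
    rw [e1, e2, e3, ← Real.exp_add, ← Real.exp_nat_mul]
    apply le_of_eq
    congr 1
    simp
    field_simp
    ring)
  rw [FL a ha, FL b hb, FL _ hm] at key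
  have pa := hpos a
  have pb := hpos b
  have pm := hpos ((a+b)/2)
  rw [← ENNReal.ofReal_mul (by positivity), ← ENNReal.ofReal_pow (by positivity),
    ENNReal.ofReal_le_ofReal_iff (by positivity)] at key
  rw [le_div_iff₀ (by positivity)]
  refine (pow_le_pow_iff_left₀ (by positivity) pm.le (two_ne_zero)).1 ?_
  have e : ((2 * Real.sqrt (a * b) / (a + b)) ^ (n + 1) * Real.sqrt (Z a * Z b)) ^ 2
      = (a ^ (n+1) * Z a * (b ^ (n+1) * Z b)) / (((a+b)/2) ^ (n+1)) ^ 2 := by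
    rw [mul_pow, Real.sq_sqrt (by positivity), ← pow_mul, mul_comm (n+1) 2, pow_mul,
      div_pow, mul_pow, Real.sq_sqrt (by positivity), ← pow_mul, mul_comm (n+1) 2, pow_mul,
      div_pow (a+b), div_pow, div_pow, mul_pow, mul_pow]
    field_simp
  rw [e, div_le_iff₀ (by positivity)]
  refine key.trans (le_of_eq ?_)
  ring
end

section
/- Let K ⊆ ℝⁿ be a convex body and let f and g be logconcave probability densities supported on K, with g > 0 on K, having centroids z_f and z_g and finite second moments. Then for every vector u ∈ ℝⁿ: ∫_K (u·(x − z_f))² f(x) dx ≤ 16 · (∫_K f(x)²/g(x) dx) · ∫_K (u·(x − z_g))² g(x) dx. -/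
open MeasureTheory
open scoped RealInnerProductSpace ENNReal

section helpers
open scoped Pointwise

lemma vc_bm_compact {t : ℝ} (h0 : 0 < t) (h1 : t < 1) {A B C : Set ℝ}
    (hA : IsCompact A) (hB : IsCompact B) (hAn : A.Nonempty) (hBn : B.Nonempty)
    (h : ∀ a ∈ A, ∀ b ∈ B, (1 - t) * a + t * b ∈ C) :
    ENNReal.ofReal (1 - t) * volume A + ENNReal.ofReal t * volume B ≤ volume C := by
  obtain ⟨a1, ha1, hmax⟩ := hA.exists_isGreatest hAn
  obtain ⟨b0, hb0, hmin⟩ := hB.exists_isLeast hBn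
  have key : ∀ (c d : ℝ) (S : Set ℝ), 0 < c →
      volume ((fun x => c * x + d) '' S) = ENNReal.ofReal c * volume S := by
    intro c d S hc
    have : (fun x => c * x + d) '' S = (fun x => x + d) '' (c • S) := by
      rw [← Set.image_smul, Set.image_image]; simp
    rw [this, Set.image_add_right, measure_preimage_add_right, Measure.addHaar_smul]
    simp [abs_of_pos hc]
  set z := (1 - t) * a1 + t * b0 with hz
  rw [← measure_inter_add_sdiff C (measurableSet_Iic (a := z))]
  gcongr
  · rw [← key (1 - t) (t * b0) A (by linarith)]
    apply measure_mono
    rintro _ ⟨a, ha, rfl⟩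
    refine ⟨h a ha b0 hb0, ?_⟩
    have := hmax ha
    simp only [Set.mem_Iic, hz]
    nlinarith
  · rw [← key t ((1 - t) * a1) B h0, 
      ← measure_sdiff_null (s := (fun x => t * x + (1 - t) * a1) '' B)
        (show volume ({z} : Set ℝ) = 0 by simp)]
    apply measure_mono
    rintro _ ⟨⟨b, hb, rfl⟩, hne⟩
    refine ⟨by simpa [add_comm] using h a1 ha1 b hb, ?_⟩
    have := hmin hb
    simp only [Set.mem_Iic, hz, not_le]
    refine lt_of_le_of_ne ?_ (fun e => hne ?_)
    · nlinarith
    · simp [← e, hz]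

lemma vc_inner_reg {A : Set ℝ} (hA : MeasurableSet A) :
    volume A = ⨆ K : {K : Set ℝ // K ⊆ A ∧ IsCompact K}, volume K.1 := by
  apply le_antisymm
  · rw [hA.measure_eq_iSup_isCompact]
    refine iSup_le fun K => iSup_le fun h => iSup_le fun h' => ?_
    exact le_iSup (fun K : {K : Set ℝ // K ⊆ A ∧ IsCompact K} => volume K.1) ⟨K, h, h'⟩
  · exact iSup_le fun K => measure_mono K.2.1

lemma vc_bm {t : ℝ} (h0 : 0 < t) (h1 : t < 1) {A B C : Set ℝ}
    (hA : MeasurableSet A) (hB : MeasurableSet B) (hAn : A.Nonempty) (hBn : B.Nonempty)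
    (h : ∀ a ∈ A, ∀ b ∈ B, (1 - t) * a + t * b ∈ C) :
    ENNReal.ofReal (1 - t) * volume A + ENNReal.ofReal t * volume B ≤ volume C := by
  obtain ⟨a, ha⟩ := hAn
  obtain ⟨b, hb⟩ := hBn
  have i1 : Nonempty {K : Set ℝ // K ⊆ A ∧ IsCompact K} := ⟨∅, by simp⟩
  have i2 : Nonempty {K : Set ℝ // K ⊆ B ∧ IsCompact K} := ⟨∅, by simp⟩
  rw [vc_inner_reg hA, vc_inner_reg hB, ENNReal.mul_iSup, ENNReal.mul_iSup, ENNReal.iSup_add]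
  refine iSup_le fun K => ?_
  rw [ENNReal.add_iSup]
  refine iSup_le fun L => ?_
  refine le_trans ?_ (vc_bm_compact h0 h1 (K.2.2.union (isCompact_singleton (x := a)))
    (L.2.2.union (isCompact_singleton (x := b))) (by simp) (by simp) (C := C) ?_)
  · gcongr <;> simp
  · intro x hx y hy
    apply h
    · rcases hx with hx | rfl
      exacts [K.2.1 hx, ha]
    · rcases hy with hx | rfl
      exacts [L.2.1 hx, hb]

lemma vc_vol_lt (y : ℝ≥0∞) : ∫⁻ s in Set.Ioi (0:ℝ), (if ENNReal.ofReal s < y then 1 else 0) = y := by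
  have : (fun s : ℝ => (if ENNReal.ofReal s < y then (1:ℝ≥0∞) else 0))
      = Set.indicator {s | ENNReal.ofReal s < y} 1 := by
    ext s; simp [Set.indicator]
  have hm : MeasurableSet {s : ℝ | ENNReal.ofReal s < y} :=
    measurableSet_lt ENNReal.measurable_ofReal measurable_const
  rw [this, lintegral_indicator_one hm, Measure.restrict_apply hm]
  by_cases hy : y = ⊤
  · subst hy
    simp
  · have : {s : ℝ | ENNReal.ofReal s < y} ∩ Set.Ioi 0 = Set.Ioo 0 y.toReal := by
      ext s
      simp only [Set.mem_inter_iff, Set.mem_ofPred_eq, Set.mem_Ioi, Set.mem_Ioo]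
      constructor
      · rintro ⟨h, h'⟩
        exact ⟨h', (ENNReal.ofReal_lt_iff_lt_toReal h'.le hy).1 h⟩
      · rintro ⟨h, h'⟩
        exact ⟨(ENNReal.ofReal_lt_iff_lt_toReal h.le hy).2 h', h⟩
    rw [this, Real.volume_Ioo, sub_zero, ENNReal.ofReal_toReal hy]

lemma vc_layer {α : Type*} [MeasurableSpace α] (μ : Measure α) [SFinite μ] {F : α → ℝ≥0∞} (hF : Measurable F) :
    ∫⁻ x, F x ∂μ = ∫⁻ s in Set.Ioi (0:ℝ), μ {x | ENNReal.ofReal s < F x} := by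
  calc ∫⁻ x, F x ∂μ = ∫⁻ x, (∫⁻ s in Set.Ioi (0:ℝ), (if ENNReal.ofReal s < F x then 1 else 0)) ∂μ := by
        simp_rw [vc_vol_lt]
    _ = ∫⁻ s in Set.Ioi (0:ℝ), ∫⁻ x, (if ENNReal.ofReal s < F x then 1 else 0) ∂μ := by
        apply lintegral_lintegral_swap
        apply Measurable.aemeasurable
        apply Measurable.ite
        · exact measurableSet_lt (by fun_prop) (by fun_prop)
        · fun_prop
        · fun_prop
    _ = _ := by
        congr 1 with s
        rw [← lintegral_indicator_one (measurableSet_lt measurable_const hF)]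
        congr 1 with x
        simp [Set.indicator]

lemma vc_amgm {t : ℝ} (h0 : 0 < t) (h1 : t < 1) (a b : ℝ≥0∞) :
    a ^ (1 - t) * b ^ t ≤ ENNReal.ofReal (1 - t) * a + ENNReal.ofReal t * b := by
  have h2 : 0 < 1 - t := by linarith
  have hpq : ((1 - t)⁻¹).HolderConjugate (t⁻¹) := by
    rw [Real.holderConjugate_iff]
    refine ⟨(one_lt_inv₀ h2).2 (by linarith), by simp⟩
  have := ENNReal.young_inequality (a ^ (1 - t)) (b ^ t) hpq
  rw [← ENNReal.rpow_mul, ← ENNReal.rpow_mul, mul_inv_cancel₀ h2.ne', mul_inv_cancel₀ h0.ne',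
    ENNReal.ofReal_inv_of_pos h2, ENNReal.ofReal_inv_of_pos h0] at this
  simpa [div_eq_mul_inv, mul_comm] using this

lemma vc_pl_norm {t : ℝ} (h0 : 0 < t) (h1 : t < 1) {F G H : ℝ → ℝ≥0∞} (hF : Measurable F)
    (hG : Measurable G) (hH : Measurable H) (sF : ⨆ x, F x = 1) (sG : ⨆ x, G x = 1)
    (h : ∀ x y, F x ^ (1 - t) * G y ^ t ≤ H ((1 - t) * x + t * y)) :
    (∫⁻ x, F x) ^ (1 - t) * (∫⁻ x, G x) ^ t ≤ ∫⁻ x, H x := by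
  have h2 : 0 < 1 - t := by linarith
  refine (vc_amgm h0 h1 _ _).trans ?_
  rw [vc_layer _ hF, vc_layer _ hG, vc_layer _ hH, ← lintegral_const_mul' _ _ (by simp),
    ← lintegral_const_mul' _ _ (by simp)]
  have mm : Measurable fun s : ℝ => volume {x | ENNReal.ofReal s < F x} := by
    apply Antitone.measurable
    intro s s' hs
    apply measure_mono
    intro x hx
    exact lt_of_le_of_lt (ENNReal.ofReal_le_ofReal hs) hx
  rw [← lintegral_add_left (mm.const_mul _)]
  apply lintegral_mono
  intro s
  by_cases hs : ENNReal.ofReal s < 1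
  · obtain ⟨x, hx⟩ := lt_iSup_iff.1 (sF.symm ▸ hs)
    obtain ⟨y, hy⟩ := lt_iSup_iff.1 (sG.symm ▸ hs)
    refine vc_bm h0 h1 (measurableSet_lt measurable_const hF)
      (measurableSet_lt measurable_const hG) ⟨x, hx⟩ ⟨y, hy⟩ ?_
    intro a ha b hb
    refine lt_of_lt_of_le ?_ (h a b)
    calc ENNReal.ofReal s = ENNReal.ofReal s ^ (1 - t) * ENNReal.ofReal s ^ t := by
          rw [← ENNReal.rpow_add_of_nonneg _ _ h2.le h0.le]; simp
      _ < _ := ENNReal.mul_lt_mul (ENNReal.rpow_lt_rpow ha h2) (ENNReal.rpow_lt_rpow hb h0)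
  · have e1 : {x | ENNReal.ofReal s < F x} = ∅ := by
      ext x; simpa using (le_iSup F x).trans (sF.le.trans (not_lt.1 hs))
    have e2 : {x | ENNReal.ofReal s < G x} = ∅ := by
      ext x; simpa using (le_iSup G x).trans (sG.le.trans (not_lt.1 hs))
    simp [e1, e2]

lemma vc_pl_bdd {t : ℝ} (h0 : 0 < t) (h1 : t < 1) {F G H : ℝ → ℝ≥0∞} (hF : Measurable F)
    (hG : Measurable G) (hH : Measurable H) (sF : ⨆ x, F x ≠ ⊤) (sG : ⨆ x, G x ≠ ⊤)
    (h : ∀ x y, F x ^ (1 - t) * G y ^ t ≤ H ((1 - t) * x + t * y)) :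
    (∫⁻ x, F x) ^ (1 - t) * (∫⁻ x, G x) ^ t ≤ ∫⁻ x, H x := by
  have h2 : 0 < 1 - t := by linarith
  set M := ⨆ x, F x with hM
  set N := ⨆ x, G x with hN
  by_cases M0 : M = 0
  · have : F = 0 := by ext x; exact le_antisymm ((le_iSup F x).trans M0.le) bot_le
    simp [this, h2]
  by_cases N0 : N = 0
  · have : G = 0 := by ext x; exact le_antisymm ((le_iSup G x).trans N0.le) bot_le
    simp [this, h0]
  set P := M ^ (1 - t) * N ^ t with hP
  have P0 : P ≠ 0 := by simp [hP, M0, N0, sF, sG]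
  have PT : P ≠ ⊤ := by
    apply ENNReal.mul_ne_top <;> apply ENNReal.rpow_ne_top_of_nonneg <;> first | positivity | assumption
  have Pi : P⁻¹ = M⁻¹ ^ (1 - t) * N⁻¹ ^ t := by
    rw [hP, ENNReal.mul_inv (by simp [M0, sF]) (by simp [N0, sG]), ENNReal.inv_rpow, ENNReal.inv_rpow]
  have key := vc_pl_norm h0 h1 (F := fun x => M⁻¹ * F x) (G := fun x => N⁻¹ * G x)
    (H := fun x => P⁻¹ * H x) (hF.const_mul _) (hG.const_mul _) (hH.const_mul _)
    (by rw [← ENNReal.mul_iSup, ENNReal.inv_mul_cancel M0 sF])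
    (by rw [← ENNReal.mul_iSup, ENNReal.inv_mul_cancel N0 sG]) (by
      intro x y
      rw [ENNReal.mul_rpow_of_nonneg _ _ h2.le, ENNReal.mul_rpow_of_nonneg _ _ h0.le,
        mul_mul_mul_comm, ← Pi]
      gcongr
      exact h x y)
  rw [lintegral_const_mul _ hF, lintegral_const_mul _ hG, lintegral_const_mul _ hH,
    ENNReal.mul_rpow_of_nonneg _ _ h2.le, ENNReal.mul_rpow_of_nonneg _ _ h0.le,
        mul_mul_mul_comm, ← Pi] at key
  exact (ENNReal.mul_le_mul_iff_right (by simpa using PT) (by simpa using P0)).1 key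

lemma vc_trunc {F : ℝ → ℝ≥0∞} (hF : Measurable F) :
    Filter.Tendsto (fun k : ℕ => ∫⁻ x, min (F x) k) Filter.atTop (nhds (∫⁻ x, F x)) := by
  apply lintegral_tendsto_of_tendsto_of_monotone
  · intro n; fun_prop
  · filter_upwards with x i j hij
    simp only
    gcongr
  · filter_upwards with x
    have : Filter.Tendsto (fun k : ℕ => min (F x) k) Filter.atTop (nhds (min (F x) ⊤)) :=
      Filter.Tendsto.min tendsto_const_nhds ENNReal.tendsto_nat_nhds_top
    simpa using this

lemma vc_pl_one {t : ℝ} (h0 : 0 < t) (h1 : t < 1) {F G H : ℝ → ℝ≥0∞} (hF : Measurable F)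
    (hG : Measurable G) (hH : Measurable H)
    (h : ∀ x y, F x ^ (1 - t) * G y ^ t ≤ H ((1 - t) * x + t * y)) :
    (∫⁻ x, F x) ^ (1 - t) * (∫⁻ x, G x) ^ t ≤ ∫⁻ x, H x := by
  have h2 : 0 < 1 - t := by linarith
  by_cases M0 : ∫⁻ x, F x = 0
  · simp [M0, h2]
  by_cases N0 : ∫⁻ x, G x = 0
  · simp [N0, h0]
  have lim := ENNReal.Tendsto.mul
    ((ENNReal.continuous_rpow_const (y := 1 - t)).continuousAt.tendsto.comp (vc_trunc hF))
    (by left; simp [M0, h2, h1.le])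
    ((ENNReal.continuous_rpow_const (y := t)).continuousAt.tendsto.comp (vc_trunc hG))
    (by left; simp [N0, h0, h0.le])
  refine le_of_tendsto' lim fun k => ?_
  refine vc_pl_bdd h0 h1 (by fun_prop) (by fun_prop) hH ?_ ?_ ?_
  · exact ne_top_of_le_ne_top (ENNReal.natCast_ne_top k) (iSup_le fun x => min_le_right _ _)
  · exact ne_top_of_le_ne_top (ENNReal.natCast_ne_top k) (iSup_le fun x => min_le_right _ _)
  · intro x y
    refine le_trans ?_ (h x y)
    gcongr <;> exact min_le_left _ _

lemma vc_pl_pi {t : ℝ} (h0 : 0 < t) (h1 : t < 1) (n : ℕ) : ∀ {F G H : (Fin n → ℝ) → ℝ≥0∞},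
    Measurable F → Measurable G → Measurable H →
    (∀ x y, F x ^ (1 - t) * G y ^ t ≤ H ((1 - t) • x + t • y)) →
    (∫⁻ x, F x) ^ (1 - t) * (∫⁻ x, G x) ^ t ≤ ∫⁻ x, H x := by
  induction n with
  | zero =>
    intro F G H hF hG hH h
    have : (volume : Measure (Fin 0 → ℝ)) = Measure.dirac 0 := by
      rw [volume_pi, Measure.pi_of_empty _ 0]
    rw [this, lintegral_dirac, lintegral_dirac, lintegral_dirac]
    simpa using h 0 0
  | succ n ih =>
    intro F G H hF hG hH h
    let e := (MeasurableEquiv.piFinSuccAbove (fun _ : Fin (n+1) => ℝ) 0).symm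
    have he : MeasurePreserving e volume volume :=
      (volume_preserving_piFinSuccAbove (fun _ : Fin (n+1) => ℝ) 0).symm
    have hadd : ∀ a b x y, e ((1 - t) * a + t * b, (1 - t) • x + t • y)
        = (1 - t) • e (a, x) + t • e (b, y) := by
      intro a b x y
      ext i
      refine Fin.cases ?_ (fun i => ?_) i <;> simp [e, MeasurableEquiv.piFinSuccAbove]
    have key : ∀ {F : (Fin (n+1) → ℝ) → ℝ≥0∞}, Measurable F →
        ∫⁻ x, F x = ∫⁻ a : ℝ, ∫⁻ x : Fin n → ℝ, F (e (a, x)) := by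
      intro F hF
      rw [← he.lintegral_comp hF]
      exact lintegral_prod _ (by have := e.measurable; fun_prop)
    have hm : ∀ {F : (Fin (n+1) → ℝ) → ℝ≥0∞}, Measurable F →
        Measurable fun a : ℝ => ∫⁻ x : Fin n → ℝ, F (e (a, x)) := by
      intro F hF
      exact (hF.comp e.measurable).lintegral_prod_right'
    rw [key hF, key hG, key hH]
    refine vc_pl_one h0 h1 (hm hF) (hm hG) (hm hH) ?_
    intro a b
    have em := e.measurable
    refine ih (by fun_prop) (by fun_prop) (by fun_prop) ?_
    intro x y
    rw [hadd]
    exact h _ _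

lemma vc_pl {t : ℝ} (h0 : 0 < t) (h1 : t < 1) (n : ℕ) {F G H : EuclideanSpace ℝ (Fin n) → ℝ≥0∞}
    (hF : Measurable F) (hG : Measurable G) (hH : Measurable H)
    (h : ∀ x y, F x ^ (1 - t) * G y ^ t ≤ H ((1 - t) • x + t • y)) :
    (∫⁻ x, F x) ^ (1 - t) * (∫⁻ x, G x) ^ t ≤ ∫⁻ x, H x := by
  have he := PiLp.volume_preserving_toLp (Fin n)
  have hm := he.measurable
  rw [← he.lintegral_comp hF, ← he.lintegral_comp hG, ← he.lintegral_comp hH]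
  refine vc_pl_pi h0 h1 n (by fun_prop) (by fun_prop) (by fun_prop) ?_
  intro x y
  simpa using h (WithLp.toLp 2 x) (WithLp.toLp 2 y)

end helpers

lemma vc_tri (y : ℝ) : ∫⁻ s in Set.Ioi (0:ℝ), ENNReal.ofReal (y - s) = ENNReal.ofReal y ^ 2 / 2 := by
  rcases le_or_gt y 0 with hy | hy
  · rw [setLIntegral_congr_fun (g := fun _ => 0) measurableSet_Ioi]
    · simp [ENNReal.ofReal_of_nonpos hy]
    · intro s hs
      have : 0 < s := hs
      exact ENNReal.ofReal_of_nonpos (by linarith)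
  · have e : Set.Ioi (0:ℝ) = Set.Ioc 0 y ∪ Set.Ioi y := by
      rw [Set.Ioc_union_Ioi_eq_Ioi hy.le]
    rw [e, lintegral_union measurableSet_Ioi (Set.Ioc_disjoint_Ioi le_rfl)]
    rw [setLIntegral_congr_fun (s := Set.Ioi y) (g := fun _ => 0) measurableSet_Ioi
      (fun s hs => ENNReal.ofReal_of_nonpos (by have : y < s := hs; linarith))]
    rw [← ofReal_integral_eq_lintegral_ofReal]
    · rw [← intervalIntegral.integral_of_le hy.le]
      have : ∫ s in (0:ℝ)..y, (y - s) = y ^ 2 / 2 := by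
        rw [intervalIntegral.integral_sub (by simp) (by simp)]
        simp; ring
      rw [this, ENNReal.ofReal_div_of_pos (by norm_num), ENNReal.ofReal_pow hy.le]
      simp
    · exact (continuous_const.sub continuous_id).integrableOn_Ioc
    · filter_upwards [ae_restrict_mem measurableSet_Ioc] with s hs
      simpa using hs.2

lemma vc_second {α : Type*} [MeasurableSpace α] (μ : Measure α) [SFinite μ] {Y : α → ℝ}
    (hY : Measurable Y) (p : ℝ≥0∞)
    (h : ∀ s r : ℝ, 0 < s → 0 < r → μ {x | s + r < Y x} * p ≤ μ {x | s < Y x} * μ {x | r < Y x}) :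
    (∫⁻ x, ENNReal.ofReal (Y x) ^ 2 ∂μ) * p ≤ 2 * (∫⁻ x, ENNReal.ofReal (Y x) ∂μ) ^ 2 := by
  have lay : ∀ {Z : α → ℝ}, Measurable Z → ∫⁻ x, ENNReal.ofReal (Z x) ∂μ
      = ∫⁻ s in Set.Ioi (0:ℝ), μ {x | s < Z x} := by
    intro Z hZ
    rw [vc_layer μ (by fun_prop)]
    refine setLIntegral_congr_fun measurableSet_Ioi ?_
    intro s hs
    simp only
    congr 1 with x
    have : 0 < s := hs
    simp only [Set.mem_ofPred_eq]
    exact ENNReal.ofReal_lt_ofReal_iff_of_nonneg this.le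
  have mm : Measurable fun s : ℝ => μ {x | s < Y x} := by
    apply Antitone.measurable
    intro s s' hs
    apply measure_mono
    intro x hx
    exact lt_of_le_of_lt hs hx
  set I := ∫⁻ x, ENNReal.ofReal (Y x) ∂μ with hI
  have e1 : I ^ 2 = ∫⁻ s in Set.Ioi (0:ℝ), ∫⁻ r in Set.Ioi (0:ℝ), μ {x | s < Y x} * μ {x | r < Y x} := by
    simp_rw [lintegral_const_mul _ mm, ← lay hY]
    rw [lintegral_mul_const _ mm, ← lay hY, sq]
  have e2 : ∫⁻ s in Set.Ioi (0:ℝ), ∫⁻ r in Set.Ioi (0:ℝ), μ {x | s + r < Y x} * p ≤ I ^ 2 := by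
    rw [e1]
    refine setLIntegral_mono' measurableSet_Ioi fun s hs => ?_
    exact setLIntegral_mono' measurableSet_Ioi fun r hr => h s r hs hr
  have e3 : ∫⁻ s in Set.Ioi (0:ℝ), ∫⁻ r in Set.Ioi (0:ℝ), μ {x | s + r < Y x} * p
      = (∫⁻ x, ENNReal.ofReal (Y x) ^ 2 / 2 ∂μ) * p := by
    have m3 : ∀ s : ℝ, Measurable fun r : ℝ => μ {x | s + r < Y x} := fun s =>
      mm.comp (measurable_const_add s)
    have : ∀ s : ℝ, ∫⁻ r in Set.Ioi (0:ℝ), μ {x | s + r < Y x} * p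
        = (∫⁻ x, ENNReal.ofReal (Y x - s) ∂μ) * p := by
      intro s
      rw [lintegral_mul_const _ (m3 s), lay (hY.sub_const s)]
      simp_rw [lt_sub_iff_add_lt, add_comm]
    simp_rw [this]
    rw [lintegral_mul_const, lintegral_lintegral_swap]
    · simp_rw [vc_tri]
    · fun_prop
    · apply Measurable.lintegral_prod_right' (f := fun z : ℝ × α => ENNReal.ofReal (Y z.2 - z.1))
      fun_prop
  rw [e3] at e2
  have : ∫⁻ x, ENNReal.ofReal (Y x) ^ 2 ∂μ = 2 * ∫⁻ x, ENNReal.ofReal (Y x) ^ 2 / 2 ∂μ := by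
    rw [← lintegral_const_mul _ (by fun_prop)]
    congr 1 with x
    rw [ENNReal.mul_div_cancel (by simp) (by simp)]
  rw [this, mul_assoc]
  gcongr

lemma vc_median {α : Type*} [MeasurableSpace α] (μ : Measure α) [IsProbabilityMeasure μ] {X : α → ℝ}
    (hX : Measurable X) : ∃ m : ℝ, 1 ≤ 2 * μ {x | m ≤ X x} ∧ 1 ≤ 2 * μ {x | X x ≤ m} := by
  have hle : ∀ s, MeasurableSet {x | X x ≤ s} := fun s => measurableSet_le hX measurable_const
  have : IsProbabilityMeasure (μ.map X) := Measure.isProbabilityMeasure_map hX.aemeasurable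
  set φ := ProbabilityTheory.cdf (μ.map X) with hφ
  have hc : ∀ s, ENNReal.ofReal (φ s) = μ {x | X x ≤ s} := by
    intro s
    rw [hφ, ProbabilityTheory.ofReal_cdf, Measure.map_apply hX measurableSet_Iic]; rfl
  have ltop := ProbabilityTheory.tendsto_cdf_atTop (μ.map X)
  have lbot := ProbabilityTheory.tendsto_cdf_atBot (μ.map X)
  set S := {s : ℝ | 1 / 2 ≤ φ s} with hS
  have Sne : S.Nonempty := (ltop.eventually (eventually_ge_nhds (by norm_num : (1/2:ℝ) < 1))).exists
  obtain ⟨b, hb⟩ := (lbot.eventually (eventually_lt_nhds (by norm_num : (0:ℝ) < 1/2))).exists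
  have Sbd : BddBelow S := by
    refine ⟨b, fun s hs => ?_⟩
    by_contra hlt
    have := φ.mono (not_le.1 hlt).le
    have h' : 1/2 ≤ φ s := hs
    linarith
  have half : ENNReal.ofReal (1/2) = 2⁻¹ := by
    rw [one_div, ENNReal.ofReal_inv_of_pos (by norm_num)]; simp
  have h22 : (2:ℝ≥0∞) * 2⁻¹ = 1 := ENNReal.mul_inv_cancel (by simp) (by simp)
  refine ⟨sInf S, ?_, ?_⟩
  · have h1 : μ {x | X x < sInf S} ≤ 2⁻¹ := by
      have : {x | X x < sInf S} = ⋃ k : ℕ, {x | X x ≤ sInf S - 1 / ((k:ℝ) + 1)} := by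
        ext x
        simp only [Set.mem_ofPred_eq, Set.mem_iUnion]
        constructor
        · intro h
          obtain ⟨k, hk⟩ := exists_nat_one_div_lt (sub_pos.2 h)
          exact ⟨k, by linarith⟩
        · rintro ⟨k, hk⟩
          have : 0 < 1 / ((k:ℝ) + 1) := by positivity
          linarith
      rw [this, Monotone.measure_iUnion]
      · refine iSup_le fun k => ?_
        rw [← hc, ← half]
        apply ENNReal.ofReal_le_ofReal
        by_contra hh
        have : sInf S ≤ sInf S - 1 / ((k:ℝ) + 1) := csInf_le Sbd (not_le.1 hh).le
        have : 0 < 1 / ((k:ℝ) + 1) := by positivity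
        linarith
      · intro i j hij x hx
        simp only [Set.mem_ofPred_eq] at hx ⊢
        refine le_trans hx ?_
        have := Nat.one_div_le_one_div (α := ℝ) hij
        linarith
    have h2 : μ {x | X x < sInf S} + μ {x | sInf S ≤ X x} = 1 := by
      rw [← measure_univ (μ := μ), ← measure_add_measure_compl (measurableSet_lt hX measurable_const)]
      congr 2; ext x; simp
    by_contra hlt
    rw [not_le] at hlt
    have h3 : μ {x | sInf S ≤ X x} < 2⁻¹ := by
      by_contra h4
      have := mul_le_mul_right (not_lt.1 h4) 2
      rw [h22] at this
      exact absurd hlt (not_lt.2 this)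
    have : μ {x | X x < sInf S} + μ {x | sInf S ≤ X x} < 2⁻¹ + 2⁻¹ :=
      ENNReal.add_lt_add_of_le_of_lt (by simp) h1 h3
    rw [h2, ENNReal.inv_two_add_inv_two] at this
    exact lt_irrefl _ this
  · rw [← hc, ← h22, ← half]
    gcongr
    have rc := (φ.right_continuous (sInf S)).tendsto.mono_left
      (nhdsWithin_mono _ Set.Ioi_subset_Ici_self)
    refine ge_of_tendsto rc ?_
    filter_upwards [self_mem_nhdsWithin] with s hs
    obtain ⟨a, ha, has⟩ := exists_lt_of_csInf_lt Sne hs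
    exact le_trans ha (φ.mono has.le)

lemma vc_med_le {α : Type*} [MeasurableSpace α] (μ : Measure α) [IsProbabilityMeasure μ] {X : α → ℝ}
    (hX : Measurable X) {m c : ℝ} (hmc : m ≤ c) (h : 1 ≤ 2 * μ {x | X x ≤ m}) :
    ∫⁻ x, ENNReal.ofReal |X x - m| ∂μ ≤ ∫⁻ x, ENNReal.ofReal |X x - c| ∂μ := by
  set δ := ENNReal.ofReal (c - m) with hδ
  have hm : MeasurableSet {x | X x ≤ m} := measurableSet_le hX measurable_const
  have pt : ∀ x, ENNReal.ofReal |X x - m| + 2 * δ * Set.indicator {x | X x ≤ m} 1 x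
      ≤ ENNReal.ofReal |X x - c| + δ := by
    intro x
    have e2 : (2:ℝ≥0∞) * δ = ENNReal.ofReal (2 * (c - m)) := by
      rw [ENNReal.ofReal_mul (by norm_num)]; simp [hδ]
    rw [hδ, ← ENNReal.ofReal_add (abs_nonneg _) (by linarith), ← hδ]
    by_cases hx : X x ≤ m
    · rw [Set.indicator_of_mem (by exact hx), e2, Pi.one_apply, mul_one,
        ← ENNReal.ofReal_add (abs_nonneg _) (by linarith)]
      apply ENNReal.ofReal_le_ofReal
      rw [abs_of_nonpos (by linarith), abs_of_nonpos (by linarith)]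
      linarith
    · rw [Set.indicator_of_notMem (by exact hx), mul_zero, add_zero]
      apply ENNReal.ofReal_le_ofReal
      have := abs_sub_le (X x) c m
      rw [abs_of_nonneg (by linarith : 0 ≤ c - m)] at this
      linarith
  have := lintegral_mono (μ := μ) pt
  rw [lintegral_add_left (by fun_prop), lintegral_add_left (by fun_prop),
    lintegral_const_mul' _ _ (by simp [hδ, ENNReal.mul_eq_top]), lintegral_indicator_one hm, lintegral_const,
    measure_univ, mul_one] at this
  have h2 : δ ≤ 2 * δ * μ {x | X x ≤ m} := by
    calc δ = 1 * δ := by simp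
      _ ≤ (2 * μ {x | X x ≤ m}) * δ := by gcongr
      _ = _ := by ring
  exact (ENNReal.add_le_add_iff_right (by simp [hδ])).1 ((add_le_add_right h2 _).trans this)

lemma vc_abstract {α : Type*} [MeasurableSpace α] (μ : Measure α) [IsProbabilityMeasure μ] {X : α → ℝ}
    (hX : Measurable X)
    (h1 : ∀ m s r : ℝ, 0 < s → 0 < r → μ {x | s + r < X x - m} * μ {x | m ≤ X x}
      ≤ μ {x | s < X x - m} * μ {x | r < X x - m})
    (h2 : ∀ m s r : ℝ, 0 < s → 0 < r → μ {x | s + r < m - X x} * μ {x | X x ≤ m}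
      ≤ μ {x | s < m - X x} * μ {x | r < m - X x}) (c : ℝ) :
    ∃ m, ∫⁻ x, ENNReal.ofReal ((X x - m) ^ 2) ∂μ
      ≤ 4 * (∫⁻ x, ENNReal.ofReal |X x - c| ∂μ) ^ 2 := by
  obtain ⟨m, hp, hq⟩ := vc_median μ hX
  refine ⟨m, ?_⟩
  have hmed : ∫⁻ x, ENNReal.ofReal |X x - m| ∂μ ≤ ∫⁻ x, ENNReal.ofReal |X x - c| ∂μ := by
    rcases le_total m c with hmc | hmc
    · exact vc_med_le μ hX hmc hq
    · have := vc_med_le μ (X := fun x => - X x) hX.neg (m := -m) (c := -c) (by linarith)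
        (by simpa using hp)
      simp_rw [show ∀ a b : ℝ, |-a - -b| = |a - b| from fun a b => by
        rw [← abs_neg]; congr 1; ring] at this
      exact this
  have gen : ∀ (I J p : ℝ≥0∞), 1 ≤ 2 * p → I * p ≤ 2 * J ^ 2 → I ≤ 4 * J ^ 2 := by
    intro I J p hp h
    calc I = I * 1 := by simp
      _ ≤ I * (2 * p) := by gcongr
      _ = 2 * (I * p) := by ring
      _ ≤ 2 * (2 * J ^ 2) := by gcongr
      _ = 4 * J ^ 2 := by ring
  have a1 := gen _ _ _ hp (vc_second μ (Y := fun x => X x - m) (by fun_prop) _ (h1 m))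
  have a2 := gen _ _ _ hq (vc_second μ (Y := fun x => m - X x) (by fun_prop) _ (h2 m))
  have s1 : ∫⁻ x, ENNReal.ofReal ((X x - m) ^ 2) ∂μ = ∫⁻ x, ENNReal.ofReal (X x - m) ^ 2 ∂μ
      + ∫⁻ x, ENNReal.ofReal (m - X x) ^ 2 ∂μ := by
    rw [← lintegral_add_left (by fun_prop)]
    congr 1 with x
    rcases le_total m (X x) with h | h
    · rw [ENNReal.ofReal_of_nonpos (by linarith : m - X x ≤ 0), ENNReal.ofReal_pow (by linarith)]; simp
    · rw [ENNReal.ofReal_of_nonpos (by linarith : X x - m ≤ 0), ← ENNReal.ofReal_pow (by linarith)]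
      simp only [ne_eq, OfNat.ofNat_ne_zero, not_false_eq_true, zero_pow, zero_add]
      congr 1; ring
  have s2 : ∫⁻ x, ENNReal.ofReal |X x - m| ∂μ = ∫⁻ x, ENNReal.ofReal (X x - m) ∂μ
      + ∫⁻ x, ENNReal.ofReal (m - X x) ∂μ := by
    rw [← lintegral_add_left (by fun_prop)]
    congr 1 with x
    rcases le_total m (X x) with h | h
    · rw [ENNReal.ofReal_of_nonpos (by linarith : m - X x ≤ 0), abs_of_nonneg (by linarith)]; simp
    · rw [ENNReal.ofReal_of_nonpos (by linarith : X x - m ≤ 0), abs_of_nonpos (by linarith)]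
      simp
  rw [s1]
  refine le_trans ?_ (mul_le_mul_right (pow_le_pow_left' hmed 2) 4)
  rw [s2]
  refine (add_le_add a1 a2).trans ?_
  rw [← mul_add]
  gcongr
  rw [add_sq]
  gcongr
  exact le_self_add

lemma vc_tail {n : ℕ} {f : EuclideanSpace ℝ (Fin n) → ℝ} (hf_meas : Measurable f)
    (hf_nonneg : ∀ x, 0 ≤ f x)
    (hf_lc : ∀ x y : EuclideanSpace ℝ (Fin n), ∀ t : ℝ, 0 ≤ t → t ≤ 1 →
      f x ^ (1 - t) * f y ^ t ≤ f ((1 - t) • x + t • y))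
    (v : EuclideanSpace ℝ (Fin n)) {t : ℝ} (h0 : 0 < t) (h1 : t < 1) (a b : ℝ) :
    (volume.withDensity (fun x => ENNReal.ofReal (f x)) {x | a ≤ ⟪v, x⟫}) ^ (1 - t)
      * (volume.withDensity (fun x => ENNReal.ofReal (f x)) {x | b < ⟪v, x⟫}) ^ t
    ≤ volume.withDensity (fun x => ENNReal.ofReal (f x)) {x | (1 - t) * a + t * b < ⟪v, x⟫} := by
  have h2 : 0 < 1 - t := by linarith
  have m1 : MeasurableSet {x : EuclideanSpace ℝ (Fin n) | a ≤ ⟪v, x⟫} :=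
    measurableSet_le measurable_const (by fun_prop)
  have m2 : ∀ b : ℝ, MeasurableSet {x : EuclideanSpace ℝ (Fin n) | b < ⟪v, x⟫} := fun b =>
    measurableSet_lt measurable_const (by fun_prop)
  have mf : Measurable fun x => ENNReal.ofReal (f x) := by fun_prop
  rw [withDensity_apply _ m1, withDensity_apply _ (m2 _), withDensity_apply _ (m2 _),
    ← lintegral_indicator m1, ← lintegral_indicator (m2 _), ← lintegral_indicator (m2 _)]
  refine vc_pl h0 h1 n (mf.indicator m1) (mf.indicator (m2 _)) (mf.indicator (m2 _)) ?_
  intro x y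
  by_cases hx : a ≤ ⟪v, x⟫
  swap
  · rw [Set.indicator_of_notMem (by exact hx)]; simp [h2]
  by_cases hy : b < ⟪v, y⟫
  swap
  · rw [Set.indicator_of_notMem (s := {x | b < ⟪v, x⟫}) (by exact hy)]; simp [h0]
  have hz : (1 - t) * a + t * b < ⟪v, (1 - t) • x + t • y⟫ := by
    rw [inner_add_right, inner_smul_right, inner_smul_right]
    nlinarith
  rw [Set.indicator_of_mem (by exact hx), Set.indicator_of_mem (by exact hy),
    Set.indicator_of_mem (by exact hz), ENNReal.ofReal_rpow_of_nonneg (hf_nonneg _) h2.le,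
    ENNReal.ofReal_rpow_of_nonneg (hf_nonneg _) h0.le, ← ENNReal.ofReal_mul (by
      have := hf_nonneg x; positivity)]
  exact ENNReal.ofReal_le_ofReal (hf_lc x y t h0.le h1.le)

lemma vc_submul {n : ℕ} {f : EuclideanSpace ℝ (Fin n) → ℝ} (hf_meas : Measurable f)
    (hf_nonneg : ∀ x, 0 ≤ f x)
    (hf_lc : ∀ x y : EuclideanSpace ℝ (Fin n), ∀ t : ℝ, 0 ≤ t → t ≤ 1 →
      f x ^ (1 - t) * f y ^ t ≤ f ((1 - t) • x + t • y))
    (v : EuclideanSpace ℝ (Fin n)) (m s r : ℝ) (hs : 0 < s) (hr : 0 < r) :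
    volume.withDensity (fun x => ENNReal.ofReal (f x)) {x | s + r < ⟪v, x⟫ - m} *
      volume.withDensity (fun x => ENNReal.ofReal (f x)) {x | m ≤ ⟪v, x⟫}
    ≤ volume.withDensity (fun x => ENNReal.ofReal (f x)) {x | s < ⟪v, x⟫ - m} *
      volume.withDensity (fun x => ENNReal.ofReal (f x)) {x | r < ⟪v, x⟫ - m} := by
  set μ := volume.withDensity (fun x => ENNReal.ofReal (f x))
  have hsr : 0 < s + r := by linarith
  have key := fun {t : ℝ} (h0 : 0 < t) (h1 : t < 1) =>
    vc_tail hf_meas hf_nonneg hf_lc v h0 h1 m (s + r + m)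
  have k1 := key (t := s / (s + r)) (by positivity) (by rw [div_lt_one hsr]; linarith)
  have k2 := key (t := r / (s + r)) (by positivity) (by rw [div_lt_one hsr]; linarith)
  have w1 : 1 - s / (s + r) = r / (s + r) := by field_simp; ring
  have w2 : 1 - r / (s + r) = s / (s + r) := by field_simp; ring
  have v1 : r / (s + r) * m + s / (s + r) * (s + r + m) = s + m := by field_simp; ring
  have v2 : s / (s + r) * m + r / (s + r) * (s + r + m) = r + m := by field_simp; ring
  rw [w1, v1] at k1
  rw [w2, v2] at k2
  simp_rw [lt_sub_iff_add_lt]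
  refine le_trans (le_of_eq ?_) (mul_le_mul' k1 k2)
  have sp : ∀ A : ℝ≥0∞, A = A ^ (r / (s + r)) * A ^ (s / (s + r)) := by
    intro A
    rw [← ENNReal.rpow_add_of_nonneg _ _ (by positivity) (by positivity), ← add_div, add_comm,
      div_self hsr.ne', ENNReal.rpow_one]
  conv_lhs => rw [sp (μ {x | s + r + m < ⟪v, x⟫}), sp (μ {x | m ≤ ⟪v, x⟫})]
  ring

/-- (Kalai–Vempala.) Let `K ⊆ ℝⁿ` be a convex body, `f, g` logconcave
probability densities supported on `K` with `g > 0` on `K`, centroids `z_f, z_g`, and finite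
second moments. Then for every vector `u`,
`∫_K (u·(x − z_f))² f(x) dx ≤ 16 (∫_K f²/g) ∫_K (u·(x − z_g))² g(x) dx`. -/
theorem variance_comparison_logconcave
    (n : ℕ) (K : Set (EuclideanSpace ℝ (Fin n)))
    (hK_compact : IsCompact K) (hK_convex : Convex ℝ K)
    (hK_interior : (interior K).Nonempty)
    (f g : EuclideanSpace ℝ (Fin n) → ℝ)
    (hf_meas : Measurable f) (hg_meas : Measurable g)
    (hf_nonneg : ∀ x, 0 ≤ f x) (hg_nonneg : ∀ x, 0 ≤ g x)
    (hf_lc : ∀ x y : EuclideanSpace ℝ (Fin n), ∀ t : ℝ, 0 ≤ t → t ≤ 1 →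
      f x ^ (1 - t) * f y ^ t ≤ f ((1 - t) • x + t • y))
    (hg_lc : ∀ x y : EuclideanSpace ℝ (Fin n), ∀ t : ℝ, 0 ≤ t → t ≤ 1 →
      g x ^ (1 - t) * g y ^ t ≤ g ((1 - t) • x + t • y))
    (hf_supp : ∀ x ∉ K, f x = 0) (hg_supp : ∀ x ∉ K, g x = 0)
    (hg_pos : ∀ x ∈ K, 0 < g x)
    (hf_int : Integrable f) (hg_int : Integrable g)
    (hf_prob : ∫ x, f x = 1) (hg_prob : ∫ x, g x = 1)
    (hf_mom1 : Integrable (fun x => f x • x)) (hg_mom1 : Integrable (fun x => g x • x))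
    (hf_mom2 : Integrable (fun x => f x * ‖x‖ ^ 2))
    (hg_mom2 : Integrable (fun x => g x * ‖x‖ ^ 2))
    (zf zg : EuclideanSpace ℝ (Fin n))
    (hzf : zf = ∫ x, f x • x) (hzg : zg = ∫ x, g x • x) :
    ∀ u : EuclideanSpace ℝ (Fin n),
      (∫⁻ x in K, ENNReal.ofReal (⟪u, x - zf⟫ ^ 2 * f x))
        ≤ 16 * (∫⁻ x in K, ENNReal.ofReal (f x ^ 2 / g x))
            * ∫⁻ x in K, ENNReal.ofReal (⟪u, x - zg⟫ ^ 2 * g x) := by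
  intro u
  set μ := volume.withDensity (fun x => ENNReal.ofReal (f x)) with hμ
  have mf : Measurable fun x => ENNReal.ofReal (f x) := by fun_prop
  have hprob : IsProbabilityMeasure μ := by
    constructor
    rw [hμ, withDensity_apply _ MeasurableSet.univ, Measure.restrict_univ,
      ← ofReal_integral_eq_lintegral_ofReal hf_int (by filter_upwards with x using hf_nonneg x), hf_prob]
    simp
  have hX : Measurable fun x : EuclideanSpace ℝ (Fin n) => ⟪u, x⟫ := by fun_prop
  obtain ⟨m, hm⟩ := vc_abstract μ (X := fun x => ⟪u, x⟫) hX
    (fun m s r hs hr => vc_submul hf_meas hf_nonneg hf_lc u m s r hs hr)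
    (fun m s r hs hr => by
      have := vc_submul hf_meas hf_nonneg hf_lc (-u) (-m) s r hs hr
      simp only [inner_neg_left, neg_le_neg_iff, sub_neg_eq_add, neg_add_eq_sub] at this
      exact this) ⟪u, zg⟫
  have h_integrable : ∀ p : EuclideanSpace ℝ (Fin n) → ℝ, Continuous p → Integrable (fun x => f x * p x) := by
    intro p hp
    have h1 : IntegrableOn (fun x => f x * p x) K :=
      hf_int.integrableOn.mul_continuousOn hp.continuousOn hK_compact
    refine (integrableOn_iff_integrable_of_support_subset ?_).1 h1
    intro x hx
    by_contra hxK
    exact hx (by simp [hf_supp x hxK])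
  have hmean : ∫ x, f x * ⟪u, x⟫ = ⟪u, zf⟫ := by
    rw [hzf, ← integral_inner hf_mom1]
    simp_rw [inner_smul_right]
  have hvar : ∫ x, f x * (⟪u, x⟫ - ⟪u, zf⟫) ^ 2 ≤ ∫ x, f x * (⟪u, x⟫ - m) ^ 2 := by
    have e : ∫ x, f x * (⟪u, x⟫ - m) ^ 2 = ∫ x, (f x * (⟪u, x⟫ - ⟪u, zf⟫) ^ 2
        + ((2 * (⟪u, zf⟫ - m)) * (f x * ⟪u, x⟫) + (m ^ 2 - ⟪u, zf⟫ ^ 2) * f x)) := by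
      congr 1 with x; ring
    have i1 : Integrable fun x => f x * ⟪u, x⟫ := h_integrable _ (by fun_prop)
    have i2 : Integrable fun x => f x * (⟪u, x⟫ - ⟪u, zf⟫) ^ 2 := h_integrable _ (by fun_prop)
    have i3 : Integrable fun x => (2 * (⟪u, zf⟫ - m)) * (f x * ⟪u, x⟫)
        + (m ^ 2 - ⟪u, zf⟫ ^ 2) * f x := (i1.const_mul _).add (hf_int.const_mul _)
    rw [e, integral_add i2 i3,
      integral_add (i1.const_mul _) (hf_int.const_mul _), integral_const_mul, integral_const_mul,
      hmean, hf_prob]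
    nlinarith [sq_nonneg (⟪u, zf⟫ - m)]
  have conv : ∀ c : ℝ, ∫⁻ x, ENNReal.ofReal ((⟪u, x⟫ - c) ^ 2) ∂μ
      = ENNReal.ofReal (∫ x, f x * (⟪u, x⟫ - c) ^ 2) := by
    intro c
    rw [hμ, lintegral_withDensity_eq_lintegral_mul _ mf (by fun_prop),
      ofReal_integral_eq_lintegral_ofReal (h_integrable _ (by fun_prop))
        (by filter_upwards with x using mul_nonneg (hf_nonneg x) (sq_nonneg _))]
    congr 1 with x
    rw [ENNReal.ofReal_mul (hf_nonneg x)]; rfl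
  have lhs : ∫⁻ x in K, ENNReal.ofReal (⟪u, x - zf⟫ ^ 2 * f x)
      ≤ ∫⁻ x, ENNReal.ofReal ((⟪u, x⟫ - m) ^ 2) ∂μ := by
    refine (setLIntegral_le_lintegral _ _).trans ?_
    rw [conv]
    refine le_trans (le_of_eq ?_) (ENNReal.ofReal_le_ofReal hvar)
    rw [ofReal_integral_eq_lintegral_ofReal (h_integrable _ (by fun_prop))
        (by filter_upwards with x using mul_nonneg (hf_nonneg x) (sq_nonneg _))]
    congr 1 with x
    rw [inner_sub_right, mul_comm]
  have cs : ∫⁻ x, ENNReal.ofReal |⟪u, x⟫ - ⟪u, zg⟫| ∂μ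
      ≤ (∫⁻ x in K, ENNReal.ofReal (f x ^ 2 / g x)) ^ (1 / 2 : ℝ)
        * (∫⁻ x in K, ENNReal.ofReal (⟪u, x - zg⟫ ^ 2 * g x)) ^ (1 / 2 : ℝ) := by
    have hKm : MeasurableSet K := hK_compact.measurableSet
    rw [hμ, lintegral_withDensity_eq_lintegral_mul _ mf (by fun_prop),
      ← setLIntegral_eq_of_support_subset (s := K)]
    swap
    · intro x hx
      by_contra hxK
      exact hx (by simp [hf_supp x hxK])
    have hol := ENNReal.lintegral_mul_le_Lp_mul_Lq (volume.restrict K) Real.HolderConjugate.two_two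
      (f := fun x => ENNReal.ofReal (f x / √(g x)))
      (g := fun x => ENNReal.ofReal (|⟪u, x - zg⟫| * √(g x))) (by fun_prop) (by fun_prop)
    refine le_trans (le_of_eq ?_) (hol.trans (le_of_eq ?_))
    · refine setLIntegral_congr_fun hKm fun x hx => ?_
      have := Real.sqrt_pos.2 (hg_pos x hx)
      have := hf_nonneg x
      simp only [Pi.mul_apply]
      rw [← ENNReal.ofReal_mul (by positivity), ← ENNReal.ofReal_mul (by positivity), inner_sub_right]
      congr 1
      field_simp
    · congr 2
      · refine setLIntegral_congr_fun hKm fun x hx => ?_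
        have := Real.sqrt_pos.2 (hg_pos x hx)
        have := hf_nonneg x
        simp only [ENNReal.rpow_two]
        rw [← ENNReal.ofReal_pow (by positivity), div_pow, Real.sq_sqrt (hg_nonneg x)]
      · refine setLIntegral_congr_fun hKm fun x hx => ?_
        simp only [ENNReal.rpow_two]
        rw [← ENNReal.ofReal_pow (by positivity), mul_pow, Real.sq_sqrt (hg_nonneg x), sq_abs]
  have sq' : ∀ A : ℝ≥0∞, (A ^ (1 / 2 : ℝ)) ^ 2 = A := by
    intro A
    rw [← ENNReal.rpow_two, ← ENNReal.rpow_mul]; simp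
  refine lhs.trans (hm.trans ?_)
  refine (mul_le_mul_right (pow_le_pow_left' cs 2) 4).trans ?_
  rw [mul_pow, sq', sq', mul_assoc]
  gcongr
  norm_num
end

section
/- Let K ⊆ ℝⁿ be a convex body and let f and g be logconcave probability densities supported on K, each positive on K, with centroids z_f and z_g, finite second moments, ∫_K f(x)²/g(x) dx ≤ 8, and ∫_K g(x)²/f(x) dx ≤ 8. If 1/2 ≤ ∫_K (u·(x − z_g))² g(x) dx ≤ 2 for every unit vector u ∈ ℝⁿ, then 1/256 ≤ ∫_K (u·(x − z_f))² f(x) dx ≤ 256 for every unit vector u ∈ ℝⁿ. -/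
open MeasureTheory
open scoped RealInnerProductSpace ENNReal

lemma inner_reg_aux {A : Set ℝ} (hA : MeasurableSet A) (p c D : ℝ≥0∞)
    (h : ∀ K ⊆ A, IsCompact K → p * volume K + c ≤ D) : p * volume A + c ≤ D := by
  have e : volume A = ⨆ K : {K : Set ℝ // K ⊆ A ∧ IsCompact K}, volume K.1 := by
    rw [hA.measure_eq_iSup_isCompact]; simp [iSup_subtype, iSup_and]
  have : Nonempty {K : Set ℝ // K ⊆ A ∧ IsCompact K} :=
    ⟨⟨∅, Set.empty_subset _, isCompact_empty⟩⟩
  rw [e, ENNReal.mul_iSup, ENNReal.iSup_add]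
  exact iSup_le fun K => h K.1 K.2.1 K.2.2

open Pointwise in
lemma bm_compact_s15 {A B C : Set ℝ} (hA : IsCompact A) (hB : IsCompact B) (hAn : A.Nonempty)
    (hBn : B.Nonempty) {p q : ℝ} (hp : 0 < p) (hq : 0 < q)
    (h : ∀ a ∈ A, ∀ b ∈ B, p * a + q * b ∈ C) :
    ENNReal.ofReal p * volume A + ENNReal.ofReal q * volume B ≤ volume C := by
  obtain ⟨a0, ha0, ha⟩ := hA.exists_isGreatest hAn
  obtain ⟨b0, hb0, hb⟩ := hB.exists_isLeast hBn
  set A' := (fun x : ℝ => p * x + q * b0) '' A with hA'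
  set B' := (fun x : ℝ => q * x + p * a0) '' B with hB'
  have key : ∀ (r c : ℝ), 0 < r → ∀ S : Set ℝ,
      volume ((fun x : ℝ => r * x + c) '' S) = ENNReal.ofReal r * volume S := by
    intro r c hr S
    have : (fun x : ℝ => r * x + c) '' S = (fun x => x + c) '' (r • S) := by
      ext y
      simp only [Set.mem_image, Set.mem_smul_set, smul_eq_mul, exists_exists_and_eq_and]
    rw [this]
    simp [Measure.addHaar_smul, abs_of_pos hr]
  have hAv : volume A' = ENNReal.ofReal p * volume A := key _ _ hp A
  have hBv : volume B' = ENNReal.ofReal q * volume B := key _ _ hq B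
  have hBm : MeasurableSet B' := (hB.image (by fun_prop)).measurableSet
  have hdis : AEDisjoint volume A' B' := by
    refine measure_mono_null (t := {p * a0 + q * b0}) ?_ (by simp)
    rintro y ⟨⟨a, haA, rfl⟩, ⟨b, hbB, hy⟩⟩
    have h1 := ha haA
    have h2 := hb hbB
    simp only [Set.mem_singleton_iff] at *
    nlinarith [mul_le_mul_of_nonneg_left h1 hp.le, mul_le_mul_of_nonneg_left h2 hq.le]
  rw [← hAv, ← hBv, ← measure_union₀ hBm.nullMeasurableSet hdis]
  refine measure_mono ?_
  rintro y (⟨a, haA, rfl⟩ | ⟨b, hbB, rfl⟩)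
  · exact h _ haA _ hb0
  · have := h _ ha0 _ hbB
    simpa [add_comm] using this

lemma bm_one {A B C : Set ℝ} (hA : MeasurableSet A) (hB : MeasurableSet B) (hAn : A.Nonempty)
    (hBn : B.Nonempty) {p q : ℝ} (hp : 0 < p) (hq : 0 < q)
    (h : ∀ a ∈ A, ∀ b ∈ B, p * a + q * b ∈ C) :
    ENNReal.ofReal p * volume A + ENNReal.ofReal q * volume B ≤ volume C := by
  obtain ⟨a, ha⟩ := hAn
  obtain ⟨b, hb⟩ := hBn
  refine inner_reg_aux hA _ _ _ fun K hK hKc => ?_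
  rw [add_comm]
  refine inner_reg_aux hB _ _ _ fun L hL hLc => ?_
  rw [add_comm]
  refine le_trans ?_ (bm_compact_s15 (A := insert a K) (B := insert b L) (hKc.insert a) (hLc.insert b)
    (Set.insert_nonempty _ _) (Set.insert_nonempty _ _) hp hq
    (fun x hx y hy => h x (Set.insert_subset ha hK hx) y (Set.insert_subset hb hL hy)))
  gcongr <;> exact Set.subset_insert _ _

lemma amgm_s15 {p q : ℝ} (hp : 0 < p) (hq : 0 < q) (hpq : p + q = 1) (x y : ℝ≥0∞) :
    x ^ p * y ^ q ≤ ENNReal.ofReal p * x + ENNReal.ofReal q * y := by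
  by_cases hx : x = ∞
  · simp [hx, ENNReal.mul_top, hp]
  by_cases hy : y = ∞
  · simp [hy, ENNReal.mul_top, hq]
  lift x to NNReal using hx
  lift y to NNReal using hy
  lift p to NNReal using hp.le
  lift q to NNReal using hq.le
  have := NNReal.geom_mean_le_arith_mean2_weighted p q x y (by exact_mod_cast hpq)
  rw [← ENNReal.coe_rpow_of_nonneg _ hp.le, ← ENNReal.coe_rpow_of_nonneg _ hq.le]
  simp only [ENNReal.ofReal_coe_nnreal]
  exact_mod_cast this

/-- layer cake for bounded functions -/
lemma layer {F : ℝ → ℝ≥0∞} (hF : Measurable F) :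
    ∫⁻ x, min (F x) 1 = ∫⁻ r in Set.Ioo (0:ℝ) 1, volume {x | ENNReal.ofReal r < F x} := by
  have hne : ∀ x, min (F x) 1 ≠ ∞ := fun x => ne_top_of_le_ne_top ENNReal.one_ne_top (min_le_right _ _)
  have h := lintegral_eq_lintegral_meas_lt (volume : Measure ℝ) (f := fun x => (min (F x) 1).toReal)
    (ae_of_all _ fun x => ENNReal.toReal_nonneg) (by fun_prop)
  simp only [ENNReal.ofReal_toReal (hne _)] at h
  rw [h, ← Set.Ioo_union_Ici_eq_Ioi (zero_lt_one' ℝ), lintegral_union measurableSet_Ici]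
  · have : ∫⁻ r in Set.Ici (1:ℝ), volume {x | r < (min (F x) 1).toReal} = 0 := by
      rw [setLIntegral_congr_fun (g := fun _ => 0) measurableSet_Ici]
      · simp
      · intro r hr
        have : {x | r < (min (F x) 1).toReal} = ∅ := by
          ext x
          simp only [Set.mem_ofPred_eq, Set.mem_empty_iff_false, iff_false, not_lt]
          refine le_trans ?_ hr
          exact ENNReal.toReal_le_of_le_ofReal zero_le_one (by simp)
        simp [this]
    rw [this, add_zero]
    refine setLIntegral_congr_fun measurableSet_Ioo fun r hr => ?_
    congr 1
    ext x
    simp only [Set.mem_ofPred_eq]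
    rw [← ENNReal.ofReal_lt_iff_lt_toReal hr.1.le (hne x), lt_min_iff]
    simp [hr.2]
  · rw [Set.disjoint_left]
    intro x hx hx2
    exact absurd hx.2 (not_lt.2 hx2)

/-- Prekopa-Leindler with normalised sup. -/
lemma pl_norm {F G H : ℝ → ℝ≥0∞} (hF : Measurable F) (hG : Measurable G) (hH : Measurable H)
    {p q : ℝ} (hp : 0 < p) (hq : 0 < q) (hpq : p + q = 1)
    (h : ∀ x y, F x ^ p * G y ^ q ≤ H (p * x + q * y))
    (sF : ⨆ x, F x = 1) (sG : ⨆ x, G x = 1) :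
    (∫⁻ x, F x) ^ p * (∫⁻ x, G x) ^ q ≤ ∫⁻ x, H x := by
  have lF : ∀ x, min (F x) 1 = F x := fun x => min_eq_left (sF ▸ le_iSup F x)
  have lG : ∀ x, min (G x) 1 = G x := fun x => min_eq_left (sG ▸ le_iSup G x)
  refine (amgm_s15 hp hq hpq _ _).trans ?_
  have eF := layer hF
  have eG := layer hG
  have eH := layer hH
  simp only [lF] at eF
  simp only [lG] at eG
  refine le_trans ?_ (lintegral_mono fun x => min_le_left (H x) 1)
  rw [eF, eG, eH]
  have mm : ∀ {F : ℝ → ℝ≥0∞}, Measurable fun r : ℝ => volume {x | ENNReal.ofReal r < F x} := by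
    intro F
    refine Antitone.measurable fun r s hrs => measure_mono fun x hx => ?_
    exact lt_of_le_of_lt (ENNReal.ofReal_le_ofReal hrs) hx
  rw [← lintegral_const_mul _ mm, ← lintegral_const_mul _ mm, ← lintegral_add_left (mm.const_mul _)]
  refine setLIntegral_mono mm fun r hr => ?_
  have r1 : ENNReal.ofReal r < 1 := by simpa using hr.2
  refine bm_one (measurableSet_lt measurable_const hF) (measurableSet_lt measurable_const hG)
    ?_ ?_ hp hq ?_
  · rw [← sF] at r1
    exact lt_iSup_iff.1 r1
  · rw [← sG] at r1
    exact lt_iSup_iff.1 r1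
  · intro a ha b hb
    refine lt_of_lt_of_le ?_ (h a b)
    have : ENNReal.ofReal r = ENNReal.ofReal r ^ p * ENNReal.ofReal r ^ q := by
      rw [← ENNReal.rpow_add _ _ (by simpa using hr.1) (by simp), hpq, ENNReal.rpow_one]
    rw [this]
    exact ENNReal.mul_lt_mul (ENNReal.rpow_lt_rpow ha hp) (ENNReal.rpow_lt_rpow hb hq)

lemma pl_bdd_s15 {F G H : ℝ → ℝ≥0∞} (hF : Measurable F) (hG : Measurable G) (hH : Measurable H)
    {p q : ℝ} (hp : 0 < p) (hq : 0 < q) (hpq : p + q = 1)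
    (h : ∀ x y, F x ^ p * G y ^ q ≤ H (p * x + q * y))
    (sF : ⨆ x, F x ≠ ∞) (sG : ⨆ x, G x ≠ ∞) :
    (∫⁻ x, F x) ^ p * (∫⁻ x, G x) ^ q ≤ ∫⁻ x, H x := by
  set a := ⨆ x, F x with ha
  set b := ⨆ x, G x with hb
  by_cases a0 : a = 0
  · have : ∀ x, F x = 0 := fun x => le_antisymm (a0 ▸ le_iSup F x) zero_le
    simp [this, hp]
  by_cases b0 : b = 0
  · have : ∀ x, G x = 0 := fun x => le_antisymm (b0 ▸ le_iSup G x) zero_le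
    simp [this, hq]
  set c := (a⁻¹) ^ p * (b⁻¹) ^ q with hc
  have c0 : c ≠ 0 := mul_ne_zero
    (by simp [ENNReal.rpow_eq_zero_iff, sF, a0]) (by simp [ENNReal.rpow_eq_zero_iff, sG, b0])
  have ct : c ≠ ∞ := ENNReal.mul_ne_top
    (ENNReal.rpow_ne_top_of_nonneg hp.le (by simpa)) (ENNReal.rpow_ne_top_of_nonneg hq.le (by simpa))
  have := pl_norm (F := fun x => a⁻¹ * F x) (G := fun x => b⁻¹ * G x) (H := fun x => c * H x)
    (hF.const_mul _) (hG.const_mul _) (hH.const_mul _) hp hq hpq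
    (fun x y => by
      rw [ENNReal.mul_rpow_of_nonneg _ _ hp.le, ENNReal.mul_rpow_of_nonneg _ _ hq.le,
        mul_mul_mul_comm]
      gcongr
      exact h x y)
    (by rw [← ENNReal.mul_iSup, ← ha, ENNReal.inv_mul_cancel a0 sF])
    (by rw [← ENNReal.mul_iSup, ← hb, ENNReal.inv_mul_cancel b0 sG])
  rw [lintegral_const_mul _ hF, lintegral_const_mul _ hG, lintegral_const_mul _ hH,
    ENNReal.mul_rpow_of_nonneg _ _ hp.le, ENNReal.mul_rpow_of_nonneg _ _ hq.le,
        mul_mul_mul_comm] at this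
  exact (ENNReal.mul_le_mul_iff_right c0 ct).1 this

lemma trunc_lim {F : ℝ → ℝ≥0∞} (hF : Measurable F) :
    Filter.Tendsto (fun N : ℕ => ∫⁻ x, min (F x) N) Filter.atTop (nhds (∫⁻ x, F x)) := by
  refine lintegral_tendsto_of_tendsto_of_monotone (fun n => by fun_prop) ?_ ?_
  · refine ae_of_all _ fun x m n hmn => ?_
    simp only
    gcongr
  · refine ae_of_all _ fun x => ?_
    have := (tendsto_const_nhds (x := F x)).min ENNReal.tendsto_nat_nhds_top
    simpa using this

/-- Prekopa-Leindler, dimension one. -/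
lemma pl_one_s15 {F G H : ℝ → ℝ≥0∞} (hF : Measurable F) (hG : Measurable G) (hH : Measurable H)
    {p q : ℝ} (hp : 0 < p) (hq : 0 < q) (hpq : p + q = 1)
    (h : ∀ x y, F x ^ p * G y ^ q ≤ H (p * x + q * y)) :
    (∫⁻ x, F x) ^ p * (∫⁻ x, G x) ^ q ≤ ∫⁻ x, H x := by
  by_cases a0 : ∫⁻ x, F x = 0
  · simp [a0, hp]
  by_cases b0 : ∫⁻ x, G x = 0
  · simp [b0, hq]
  refine le_of_tendsto (ENNReal.Tendsto.mul ((trunc_lim hF).ennrpow_const p) ?_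
    ((trunc_lim hG).ennrpow_const q) ?_) (Filter.Eventually.of_forall fun N => ?_)
  · left; simp [ENNReal.rpow_eq_zero_iff, a0, hp.le]
  · left; simp [ENNReal.rpow_eq_zero_iff, b0, hq.le]
  · refine pl_bdd_s15 (by fun_prop) (by fun_prop) hH hp hq hpq (fun x y => ?_) ?_ ?_
    · refine le_trans ?_ (h x y)
      gcongr <;> exact min_le_left _ _
    · exact ne_top_of_le_ne_top (ENNReal.natCast_ne_top N) (iSup_le fun x => min_le_right _ _)
    · exact ne_top_of_le_ne_top (ENNReal.natCast_ne_top N) (iSup_le fun x => min_le_right _ _)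

/-- Prekopa-Leindler on `Fin n → ℝ`. -/
lemma pl_pi (n : ℕ) : ∀ {F G H : (Fin n → ℝ) → ℝ≥0∞} (_ : Measurable F) (_ : Measurable G)
    (_ : Measurable H) {p q : ℝ} (_ : 0 < p) (_ : 0 < q) (_ : p + q = 1)
    (_ : ∀ x y, F x ^ p * G y ^ q ≤ H (p • x + q • y)),
    (∫⁻ x, F x) ^ p * (∫⁻ x, G x) ^ q ≤ ∫⁻ x, H x := by
  induction n with
  | zero =>
    intro F G H hF hG hH p q hp hq hpq h
    rw [volume_pi, Measure.pi_of_empty]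
    simp only [lintegral_dirac]
    convert h _ _
  | succ n ih =>
    intro F G H hF hG hH p q hp hq hpq h
    set e := (MeasurableEquiv.piFinSuccAbove (fun _ : Fin (n+1) => ℝ) 0).symm with he
    have mp : MeasurePreserving e := (volume_preserving_piFinSuccAbove (fun _ => ℝ) 0).symm
    have key : ∀ {F : (Fin (n+1) → ℝ) → ℝ≥0∞}, Measurable F →
        ∫⁻ x, F x = ∫⁻ a : ℝ, ∫⁻ y : Fin n → ℝ, F (e (a, y)) := by
      intro F hF
      rw [← mp.lintegral_comp hF, Measure.volume_eq_prod, lintegral_prod]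
      exact (hF.comp e.measurable).aemeasurable
    have meas : ∀ {F : (Fin (n+1) → ℝ) → ℝ≥0∞}, Measurable F →
        Measurable fun a : ℝ => ∫⁻ y : Fin n → ℝ, F (e (a, y)) := by
      intro F hF
      exact (hF.comp e.measurable).lintegral_prod_right'
    rw [key hF, key hG, key hH]
    refine pl_one_s15 (meas hF) (meas hG) (meas hH) hp hq hpq fun a b => ?_
    have m2 : ∀ {F : (Fin (n+1) → ℝ) → ℝ≥0∞}, Measurable F → ∀ a : ℝ,
        Measurable fun y : Fin n → ℝ => F (e (a, y)) := by
      intro F hF a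
      exact (hF.comp e.measurable).comp measurable_prodMk_left
    refine ih (m2 hF a) (m2 hG b) (m2 hH _) hp hq hpq fun x y => ?_
    refine (h _ _).trans (le_of_eq ?_)
    congr 1
    ext i
    refine Fin.cases ?_ (fun j => ?_) i
    · simp [he, MeasurableEquiv.piFinSuccAbove]
    · simp [he, MeasurableEquiv.piFinSuccAbove]

lemma pl_euclid {n : ℕ} {F G H : EuclideanSpace ℝ (Fin n) → ℝ≥0∞} (hF : Measurable F)
    (hG : Measurable G) (hH : Measurable H) {p q : ℝ} (hp : 0 < p) (hq : 0 < q) (hpq : p + q = 1)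
    (h : ∀ x y, F x ^ p * G y ^ q ≤ H (p • x + q • y)) :
    (∫⁻ x, F x) ^ p * (∫⁻ x, G x) ^ q ≤ ∫⁻ x, H x := by
  have mp := PiLp.volume_preserving_toLp (Fin n)
  rw [← mp.lintegral_comp hF, ← mp.lintegral_comp hG, ← mp.lintegral_comp hH]
  refine pl_pi n (hF.comp mp.measurable) (hG.comp mp.measurable) (hH.comp mp.measurable)
    hp hq hpq fun x y => ?_
  simpa using h (WithLp.toLp 2 x) (WithLp.toLp 2 y)

lemma tail_bound {n : ℕ} {f : EuclideanSpace ℝ (Fin n) → ℝ} (hf : Measurable f)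
    (hf0 : ∀ x, 0 ≤ f x)
    (hlc : ∀ x y : EuclideanSpace ℝ (Fin n), ∀ t : ℝ, 0 ≤ t → t ≤ 1 →
      f x ^ (1 - t) * f y ^ t ≤ f ((1 - t) • x + t • y))
    (ν : Measure (EuclideanSpace ℝ (Fin n)))
    (hν : ν = volume.withDensity fun x => ENNReal.ofReal (f x)) [IsProbabilityMeasure ν]
    (u : EuclideanSpace ℝ (Fin n)) (c : ℝ)
    (h2 : ∫⁻ x, ENNReal.ofReal ((⟪u, x⟫ - c) ^ 2) ∂ν ≤ 1) {t : ℝ} (ht : 3 < t) :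
    ν {x | t < |⟪u, x⟫ - c|} ≤ ENNReal.ofReal (Real.exp (-(t + 3) / 3)) := by
  set φ : EuclideanSpace ℝ (Fin n) → ℝ := fun x => ⟪u, x⟫ - c with hφ
  have φm : Measurable fun x => |φ x| := by fun_prop
  set q : ℝ := 6 / (t + 3) with hq
  have hqt : q * (t + 3) = 6 := by rw [hq]; field_simp
  have q0 : 0 < q := by positivity
  have q1 : q < 1 := by rw [hq, div_lt_one (by linarith)]; linarith
  set A := {x | |φ x| ≤ 3} with hA
  set B := {x | t < |φ x|} with hB
  set C := {x | 3 < |φ x|} with hC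
  have mA : MeasurableSet A := measurableSet_le φm measurable_const
  have mB : MeasurableSet B := measurableSet_lt measurable_const φm
  have mC : MeasurableSet C := measurableSet_lt measurable_const φm
  have fm : Measurable fun x => ENNReal.ofReal (f x) := by fun_prop
  have νi : ∀ S, MeasurableSet S → ν S = ∫⁻ x, S.indicator (fun x => ENNReal.ofReal (f x)) x := by
    intro S hS
    rw [hν, withDensity_apply _ hS, lintegral_indicator hS]
  have pl : ν A ^ (1 - q) * ν B ^ q ≤ ν C := by
    rw [νi A mA, νi B mB, νi C mC]
    refine pl_euclid (fm.indicator mA) (fm.indicator mB) (fm.indicator mC) (by linarith) q0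
      (by ring) fun x y => ?_
    by_cases hx : x ∈ A
    swap
    · rw [Set.indicator_of_notMem hx, ENNReal.zero_rpow_of_pos (by linarith)]; simp
    by_cases hy : y ∈ B
    swap
    · rw [Set.indicator_of_notMem hy, ENNReal.zero_rpow_of_pos q0]; simp
    have hz : (1 - q) • x + q • y ∈ C := by
      have e : φ ((1 - q) • x + q • y) = (1 - q) * φ x + q * φ y := by
        simp only [hφ, inner_add_right, inner_smul_right]; ring
      change 3 < |φ ((1 - q) • x + q • y)|
      rw [e]
      have hx' : |φ x| ≤ 3 := hx
      have hy' : t < |φ y| := hy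
      have h1 : |q * φ y| ≤ |(1 - q) * φ x + q * φ y| + |(1 - q) * φ x| := by
        have := abs_sub ((1 - q) * φ x + q * φ y) ((1 - q) * φ x)
        simpa using this
      rw [abs_mul, abs_mul (1 - q), abs_of_pos q0, abs_of_pos (by linarith : 0 < 1 - q)] at h1
      nlinarith [mul_le_mul_of_nonneg_left hx' (by linarith : 0 ≤ 1 - q),
        mul_lt_mul_of_pos_left hy' q0]
    rw [Set.indicator_of_mem hx, Set.indicator_of_mem hy, Set.indicator_of_mem hz,
      ENNReal.ofReal_rpow_of_nonneg (hf0 x) (by linarith),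
      ENNReal.ofReal_rpow_of_nonneg (hf0 y) q0.le, ← ENNReal.ofReal_mul (by have := hf0 x; positivity)]
    exact ENNReal.ofReal_le_ofReal (hlc x y q q0.le q1.le)
  have hCm : ν.real C ≤ 1 / 9 := by
    have := (mul_meas_ge_le_lintegral (μ := ν) (f := fun x => ENNReal.ofReal (φ x ^ 2))
      (by fun_prop) 9).trans h2
    have sub : ν C ≤ ν {x | 9 ≤ ENNReal.ofReal (φ x ^ 2)} := by
      refine measure_mono fun x hx => ?_
      have hx' : 3 < |φ x| := hx
      change (9 : ℝ≥0∞) ≤ ENNReal.ofReal (φ x ^ 2)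
      rw [← ENNReal.ofReal_ofNat 9]
      refine ENNReal.ofReal_le_ofReal ?_
      rw [← sq_abs]; nlinarith
    have h3 : 9 * ν C ≤ 1 := le_trans (by gcongr) this
    have h4 := ENNReal.toReal_mono ENNReal.one_ne_top h3
    rw [ENNReal.toReal_mul] at h4
    simp only [ENNReal.toReal_ofNat, ENNReal.toReal_one] at h4
    change (ν C).toReal ≤ 1 / 9
    linarith
  have hAC : ν.real A = 1 - ν.real C := by
    have : A = Cᶜ := by ext x; simp [hA, hC]
    rw [this, probReal_compl_eq_one_sub mC]
  have plr : ν.real A ^ (1 - q) * ν.real B ^ q ≤ ν.real C := by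
    have := ENNReal.toReal_mono (measure_ne_top ν C) pl
    rwa [ENNReal.toReal_mul, ← ENNReal.toReal_rpow, ← ENNReal.toReal_rpow] at this
  have hB0 : 0 ≤ ν.real B := measureReal_nonneg
  have a1 : (8 / 9 : ℝ) ≤ ν.real A ^ (1 - q) := by
    calc (8 / 9 : ℝ) = (8 / 9 : ℝ) ^ (1 : ℝ) := by simp
      _ ≤ (8 / 9 : ℝ) ^ (1 - q) :=
        Real.rpow_le_rpow_of_exponent_ge (by norm_num) (by norm_num) (by linarith)
      _ ≤ _ := Real.rpow_le_rpow (by norm_num) (by linarith) (by linarith)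
  have b1 : ν.real B ^ q ≤ 1 / 8 := by
    have : 0 ≤ ν.real B ^ q := by positivity
    nlinarith [mul_le_mul_of_nonneg_right a1 this]
  have e8 : (1 / 8 : ℝ) ≤ Real.exp (-2) := by
    rw [Real.exp_neg, one_div]
    refine inv_anti₀ (Real.exp_pos _) ?_
    have : Real.exp 2 = Real.exp 1 * Real.exp 1 := by rw [← Real.exp_add]; norm_num
    rw [this]
    nlinarith [Real.exp_one_lt_d9, Real.exp_pos 1]
  have b2 : ν.real B ≤ Real.exp (-(t + 3) / 3) := by
    have h5 : ν.real B = (ν.real B ^ q) ^ (1 / q) := by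
      rw [← Real.rpow_mul hB0, mul_one_div_cancel q0.ne', Real.rpow_one]
    have h6 : Real.exp (-(t + 3) / 3) = Real.exp (-2) ^ (1 / q) := by
      rw [← Real.exp_mul]
      congr 1
      rw [hq]; field_simp; norm_num
    rw [h5, h6]
    exact Real.rpow_le_rpow (by positivity) (b1.trans e8) (by positivity)
  rw [← ENNReal.ofReal_toReal (measure_ne_top ν B)]
  exact ENNReal.ofReal_le_ofReal b2

lemma fourth_moment {n : ℕ} {f : EuclideanSpace ℝ (Fin n) → ℝ} (hf : Measurable f)
    (hf0 : ∀ x, 0 ≤ f x)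
    (hlc : ∀ x y : EuclideanSpace ℝ (Fin n), ∀ t : ℝ, 0 ≤ t → t ≤ 1 →
      f x ^ (1 - t) * f y ^ t ≤ f ((1 - t) • x + t • y))
    (ν : Measure (EuclideanSpace ℝ (Fin n)))
    (hν : ν = volume.withDensity fun x => ENNReal.ofReal (f x)) [IsProbabilityMeasure ν]
    (u : EuclideanSpace ℝ (Fin n)) (c : ℝ)
    (h2 : ∫⁻ x, ENNReal.ofReal ((⟪u, x⟫ - c) ^ 2) ∂ν ≤ 1) :
    ∫⁻ x, ENNReal.ofReal ((⟪u, x⟫ - c) ^ 4) ∂ν ≤ ENNReal.ofReal 1200 := by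
  have lc := lintegral_rpow_eq_lintegral_meas_lt_mul ν (f := fun x => |⟪u, x⟫ - c|)
    (ae_of_all _ fun x => abs_nonneg _) (by fun_prop) (p := 4) (by norm_num)
  have e4 : ∀ x, |⟪u, x⟫ - c| ^ (4 : ℝ) = (⟪u, x⟫ - c) ^ 4 := by
    intro x
    rw [show (4 : ℝ) = ((4 : ℕ) : ℝ) by norm_num, Real.rpow_natCast, Even.pow_abs (by decide)]
  simp only [e4] at lc
  rw [lc]
  have hint : IntegrableOn (fun t : ℝ => t ^ (3 : ℝ) * Real.exp (-((1 / 3) * t ))) (Set.Ioi 0) := by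
    have := integrableOn_rpow_mul_exp_neg_mul_rpow (p := 1) (s := 3) (b := 1 / 3)
      (by norm_num) (by norm_num) (by norm_num)
    refine this.congr_fun (fun t _ => ?_) measurableSet_Ioi
    simp
  have hval : ∫ t : ℝ in Set.Ioi 0, t ^ (3 : ℝ) * Real.exp (-((1 / 3) * t)) = 486 := by
    have := Real.integral_rpow_mul_exp_neg_mul_Ioi (a := 4) (r := 1 / 3) (by norm_num) (by norm_num)
    rw [show (4 : ℝ) - 1 = 3 by norm_num] at this
    rw [this, show (4 : ℝ) = ((3 : ℕ) : ℝ) + 1 by norm_num, Real.Gamma_nat_eq_factorial,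
      show ((3 : ℕ) : ℝ) + 1 = ((4 : ℕ) : ℝ) by norm_num, Real.rpow_natCast]
    norm_num [Nat.factorial]
  have bd : ∀ t ∈ Set.Ioi (0 : ℝ), ν {a | t < |⟪u, a⟫ - c|} * ENNReal.ofReal (t ^ ((4 : ℝ) - 1)) ≤
      (Set.Ioc (0 : ℝ) 3).indicator (fun _ => ENNReal.ofReal 27) t
        + ENNReal.ofReal (Real.exp (-1)) *
          ENNReal.ofReal (t ^ (3 : ℝ) * Real.exp (-((1 / 3) * t))) := by
    intro t ht
    have ht0 : 0 < t := ht
    rw [show (4 : ℝ) - 1 = 3 by norm_num]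
    by_cases h3 : t ≤ 3
    · rw [Set.indicator_of_mem (by exact ⟨ht0, h3⟩)]
      refine le_trans ?_ le_self_add
      calc _ ≤ 1 * ENNReal.ofReal 27 := by
            gcongr
            · exact prob_le_one
            · rw [show (3 : ℝ) = ((3 : ℕ) : ℝ) by norm_num, Real.rpow_natCast]
              calc t ^ 3 ≤ 3 ^ 3 := by gcongr
                _ = 27 := by norm_num
        _ = _ := one_mul _
    · refine le_trans ?_ le_add_self
      calc _ ≤ ENNReal.ofReal (Real.exp (-(t + 3) / 3)) * ENNReal.ofReal (t ^ (3 : ℝ)) := by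
            gcongr
            exact tail_bound hf hf0 hlc ν hν u c h2 (not_le.1 h3)
        _ = _ := by
            rw [← ENNReal.ofReal_mul (Real.exp_pos _).le, ← ENNReal.ofReal_mul (Real.exp_pos _).le]
            congr 1
            rw [show -(t + 3) / 3 = -1 + -((1 / 3) * t) by ring, Real.exp_add]
            ring
  have m1 : Measurable fun t : ℝ => (Set.Ioc (0 : ℝ) 3).indicator (fun _ => ENNReal.ofReal 27) t :=
    measurable_const.indicator measurableSet_Ioc
  have m2 : Measurable fun t : ℝ => ENNReal.ofReal (t ^ (3 : ℝ) * Real.exp (-((1 / 3) * t))) := by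
    fun_prop
  have e1 : Real.exp (-1) ≤ 0.4 := by
    rw [Real.exp_neg]
    exact inv_le_of_inv_le₀ (by norm_num) (by linarith [Real.exp_one_gt_d9])
  calc _ ≤ ENNReal.ofReal 4 * ∫⁻ t in Set.Ioi (0 : ℝ),
        ((Set.Ioc (0 : ℝ) 3).indicator (fun _ => ENNReal.ofReal 27) t
        + ENNReal.ofReal (Real.exp (-1)) *
          ENNReal.ofReal (t ^ (3 : ℝ) * Real.exp (-((1 / 3) * t)))) := by
        refine mul_le_mul_right ?_ _
        exact setLIntegral_mono (m1.add (m2.const_mul _)) bd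
    _ ≤ ENNReal.ofReal 4 * (ENNReal.ofReal 81 + ENNReal.ofReal 0.4 * ENNReal.ofReal 486) := by
        rw [lintegral_add_left m1, lintegral_const_mul _ m2,
          ← ofReal_integral_eq_lintegral_ofReal hint, hval]
        · gcongr
          refine (setLIntegral_le_lintegral _ _).trans ?_
          rw [lintegral_indicator measurableSet_Ioc, setLIntegral_const, Real.volume_Ioc,
            ← ENNReal.ofReal_mul (by norm_num)]
          norm_num
        · filter_upwards [ae_restrict_mem measurableSet_Ioi] with t ht
          have ht0 : 0 < t := ht
          positivity
    _ ≤ _ := by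
        rw [← ENNReal.ofReal_mul (by norm_num), ← ENNReal.ofReal_add (by norm_num) (by norm_num),
          ← ENNReal.ofReal_mul (by norm_num)]
        exact ENNReal.ofReal_le_ofReal (by norm_num)

lemma variance_min {n : ℕ} {K : Set (EuclideanSpace ℝ (Fin n))} (hK : IsCompact K)
    {f : EuclideanSpace ℝ (Fin n) → ℝ} (hsupp : ∀ x ∉ K, f x = 0) (hint : Integrable f)
    (hprob : ∫ x, f x = 1) (hmom : Integrable (fun x => f x • x))
    {z : EuclideanSpace ℝ (Fin n)} (hz : z = ∫ x, f x • x) (u : EuclideanSpace ℝ (Fin n)) (c : ℝ) :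
    ∫ x in K, ⟪u, x - z⟫ ^ 2 * f x ≤ ∫ x in K, (⟪u, x⟫ - c) ^ 2 * f x := by
  have h0 : ∫ x in K, f x = 1 := by
    rw [setIntegral_eq_integral_of_forall_compl_eq_zero hsupp, hprob]
  have h1 : ∫ x in K, ⟪u, x⟫ * f x = ⟪u, z⟫ := by
    rw [setIntegral_eq_integral_of_forall_compl_eq_zero (fun x hx => by simp [hsupp x hx]), hz,
      ← integral_inner hmom]
    refine integral_congr_ae (ae_of_all _ fun x => ?_)
    simp only [inner_smul_right]; ring
  have i0 : IntegrableOn f K := hint.integrableOn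
  have i1 : IntegrableOn (fun x => ⟪u, x⟫ * f x) K :=
    i0.continuousOn_mul (by fun_prop) hK
  have i2 : IntegrableOn (fun x => ⟪u, x - z⟫ ^ 2 * f x) K :=
    i0.continuousOn_mul (by fun_prop) hK
  have i3 : IntegrableOn (fun x => ⟪u, x - z⟫ ^ 2 * f x + 2 * (⟪u, z⟫ - c) * (⟪u, x⟫ * f x)) K :=
    i2.add (i1.const_mul _)
  have e : ∫ x in K, (⟪u, x⟫ - c) ^ 2 * f x = (∫ x in K, ⟪u, x - z⟫ ^ 2 * f x) +
      (2 * (⟪u, z⟫ - c) * ∫ x in K, ⟪u, x⟫ * f x) + (c ^ 2 - ⟪u, z⟫ ^ 2) * ∫ x in K, f x := by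
    rw [← integral_const_mul, ← integral_const_mul, ← integral_add i2 (i1.const_mul _),
      ← integral_add i3 (i0.const_mul _)]
    refine integral_congr_ae (ae_of_all _ fun x => ?_)
    simp only [inner_sub_right]; ring
  rw [e, h0, h1]
  nlinarith [sq_nonneg (⟪u, z⟫ - c)]

lemma transfer {n : ℕ} {K : Set (EuclideanSpace ℝ (Fin n))} (hK : IsCompact K)
    {f g : EuclideanSpace ℝ (Fin n) → ℝ} (hf : Measurable f) (hg : Measurable g)
    (hf0 : ∀ x, 0 ≤ f x) (hg0 : ∀ x, 0 ≤ g x)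
    (hlc : ∀ x y : EuclideanSpace ℝ (Fin n), ∀ t : ℝ, 0 ≤ t → t ≤ 1 →
      f x ^ (1 - t) * f y ^ t ≤ f ((1 - t) • x + t • y))
    (hsupp : ∀ x ∉ K, f x = 0) (hpos : ∀ x ∈ K, 0 < f x) (hint : Integrable f)
    (hprob : ∫ x, f x = 1)
    (hwarm : (∫⁻ x in K, ENNReal.ofReal (g x ^ 2 / f x)) ≤ 8)
    (u : EuclideanSpace ℝ (Fin n)) (c : ℝ) {m : ℝ} (hm : 0 < m)
    (h2 : ∫ x in K, (⟪u, x⟫ - c) ^ 2 * f x ≤ m ^ 2) {a : ℝ} (ha : 0 < a) :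
    ∫ x in K, (⟪u, x⟫ - c) ^ 2 * g x ≤ a / 2 * (1200 * m ^ 4) + 4 / a := by
  have mK : MeasurableSet K := hK.measurableSet
  set ν := volume.withDensity fun x => ENNReal.ofReal (f x) with hν
  have : IsProbabilityMeasure ν := by
    constructor
    rw [hν, withDensity_apply _ MeasurableSet.univ, setLIntegral_univ,
      ← ofReal_integral_eq_lintegral_ofReal hint (ae_of_all _ hf0), hprob, ENNReal.ofReal_one]
  have conv : ∀ h : EuclideanSpace ℝ (Fin n) → ℝ, Measurable h →
      ∫⁻ x, ENNReal.ofReal (h x) ∂ν = ∫⁻ x in K, ENNReal.ofReal (h x * f x) := by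
    intro h hh
    rw [hν, lintegral_withDensity_eq_lintegral_mul _ (by fun_prop) (by fun_prop),
      ← lintegral_indicator mK]
    refine lintegral_congr fun x => ?_
    by_cases hx : x ∈ K
    · rw [Set.indicator_of_mem hx, mul_comm (h x), ENNReal.ofReal_mul (hf0 x)]; rfl
    · rw [Set.indicator_of_notMem hx]; simp [hsupp x hx]
  have i2 : IntegrableOn (fun x => (⟪u, x⟫ - c) ^ 2 * f x) K :=
    hint.integrableOn.continuousOn_mul (by fun_prop) hK
  have es : ∀ x, ⟪m⁻¹ • u, x⟫ - m⁻¹ * c = m⁻¹ * (⟪u, x⟫ - c) := by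
    intro x
    rw [real_inner_smul_left]; ring
  have k2 : ∫⁻ x, ENNReal.ofReal ((⟪m⁻¹ • u, x⟫ - m⁻¹ * c) ^ 2) ∂ν ≤ 1 := by
    rw [conv _ (by fun_prop)]
    simp only [es, mul_pow, mul_assoc]
    rw [← ofReal_integral_eq_lintegral_ofReal (i2.const_mul _)
      (ae_of_all _ fun x => by have := hf0 x; positivity), integral_const_mul,
      ← ENNReal.ofReal_one]
    refine ENNReal.ofReal_le_ofReal ?_
    calc (m⁻¹) ^ 2 * _ ≤ (m⁻¹) ^ 2 * m ^ 2 := by gcongr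
      _ = 1 := by field_simp
  have k4 := fourth_moment hf hf0 hlc ν hν (m⁻¹ • u) (m⁻¹ * c) k2
  rw [conv _ (by fun_prop)] at k4
  have k4' : ∫⁻ x in K, ENNReal.ofReal ((⟪u, x⟫ - c) ^ 4 * f x) ≤ ENNReal.ofReal (1200 * m ^ 4) := by
    have e : ∀ x, ENNReal.ofReal ((⟪u, x⟫ - c) ^ 4 * f x) = ENNReal.ofReal (m ^ 4) *
        ENNReal.ofReal ((⟪m⁻¹ • u, x⟫ - m⁻¹ * c) ^ 4 * f x) := by
      intro x
      rw [es, ← ENNReal.ofReal_mul (by positivity)]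
      congr 1
      field_simp
    simp only [e]
    rw [lintegral_const_mul _ (by fun_prop), mul_comm 1200, ENNReal.ofReal_mul (by positivity)]
    gcongr
  rw [integral_eq_lintegral_of_nonneg_ae
    (ae_of_all _ fun x => by have := hg0 x; positivity) (by fun_prop)]
  refine ENNReal.toReal_le_of_le_ofReal (by positivity) ?_
  calc _ ≤ ∫⁻ x in K, (ENNReal.ofReal (a / 2) * ENNReal.ofReal ((⟪u, x⟫ - c) ^ 4 * f x) +
        ENNReal.ofReal (1 / (2 * a)) * ENNReal.ofReal (g x ^ 2 / f x)) := by
        refine setLIntegral_mono (by fun_prop) fun x hx => ?_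
        have hfx := hpos x hx
        rw [← ENNReal.ofReal_mul (by positivity), ← ENNReal.ofReal_mul (by positivity),
          ← ENNReal.ofReal_add (by positivity) (by positivity)]
        refine ENNReal.ofReal_le_ofReal ?_
        generalize ⟪u, x⟫ - c = y
        have : a / 2 * (y ^ 4 * f x) + 1 / (2 * a) * (g x ^ 2 / f x) - y ^ 2 * g x =
            (a * y ^ 2 * f x - g x) ^ 2 / (2 * a * f x) := by
          field_simp; ring
        have h0 : 0 ≤ (a * y ^ 2 * f x - g x) ^ 2 / (2 * a * f x) := by positivity
        linarith
    _ ≤ ENNReal.ofReal (a / 2) * ENNReal.ofReal (1200 * m ^ 4) +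
        ENNReal.ofReal (1 / (2 * a)) * ENNReal.ofReal 8 := by
        rw [lintegral_add_left (by fun_prop), lintegral_const_mul _ (by fun_prop),
          lintegral_const_mul _ (by fun_prop)]
        gcongr
        simpa using hwarm
    _ = _ := by
        rw [← ENNReal.ofReal_mul (by positivity), ← ENNReal.ofReal_mul (by positivity),
          ← ENNReal.ofReal_add (by positivity) (by positivity)]
        congr 1
        field_simp; norm_num

/-- Near-isotropy transfers between consecutive annealing densities.
Let `K ⊆ ℝⁿ` be a convex body and `f, g` logconcave probability densities supported on `K`,
positive on `K`, with centroids `z_f, z_g`, finite second moments, and warmness bounds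
`∫_K f²/g ≤ 8` and `∫_K g²/f ≤ 8`. If `1/2 ≤ ∫_K (u·(x−z_g))² g ≤ 2` for every unit vector
`u`, then `1/256 ≤ ∫_K (u·(x−z_f))² f ≤ 256` for every unit vector `u`. -/
theorem near_isotropy_transfer
    (n : ℕ) (K : Set (EuclideanSpace ℝ (Fin n)))
    (hK_compact : IsCompact K) (hK_convex : Convex ℝ K)
    (hK_interior : (interior K).Nonempty)
    (f g : EuclideanSpace ℝ (Fin n) → ℝ)
    (hf_meas : Measurable f) (hg_meas : Measurable g)
    (hf_nonneg : ∀ x, 0 ≤ f x) (hg_nonneg : ∀ x, 0 ≤ g x)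
    (hf_lc : ∀ x y : EuclideanSpace ℝ (Fin n), ∀ t : ℝ, 0 ≤ t → t ≤ 1 →
      f x ^ (1 - t) * f y ^ t ≤ f ((1 - t) • x + t • y))
    (hg_lc : ∀ x y : EuclideanSpace ℝ (Fin n), ∀ t : ℝ, 0 ≤ t → t ≤ 1 →
      g x ^ (1 - t) * g y ^ t ≤ g ((1 - t) • x + t • y))
    (hf_supp : ∀ x ∉ K, f x = 0) (hg_supp : ∀ x ∉ K, g x = 0)
    (hf_pos : ∀ x ∈ K, 0 < f x) (hg_pos : ∀ x ∈ K, 0 < g x)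
    (hf_int : Integrable f) (hg_int : Integrable g)
    (hf_prob : ∫ x, f x = 1) (hg_prob : ∫ x, g x = 1)
    (hf_mom1 : Integrable (fun x => f x • x)) (hg_mom1 : Integrable (fun x => g x • x))
    (hf_mom2 : Integrable (fun x => f x * ‖x‖ ^ 2))
    (hg_mom2 : Integrable (fun x => g x * ‖x‖ ^ 2))
    (zf zg : EuclideanSpace ℝ (Fin n))
    (hzf : zf = ∫ x, f x • x) (hzg : zg = ∫ x, g x • x)
    (hwarm_fg : (∫⁻ x in K, ENNReal.ofReal (f x ^ 2 / g x)) ≤ 8)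
    (hwarm_gf : (∫⁻ x in K, ENNReal.ofReal (g x ^ 2 / f x)) ≤ 8)
    (hg_iso : ∀ u : EuclideanSpace ℝ (Fin n), ‖u‖ = 1 →
      1 / 2 ≤ (∫ x in K, ⟪u, x - zg⟫ ^ 2 * g x) ∧ (∫ x in K, ⟪u, x - zg⟫ ^ 2 * g x) ≤ 2) :
    ∀ u : EuclideanSpace ℝ (Fin n), ‖u‖ = 1 →
      1 / 256 ≤ (∫ x in K, ⟪u, x - zf⟫ ^ 2 * f x) ∧
        (∫ x in K, ⟪u, x - zf⟫ ^ 2 * f x) ≤ 256 := by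
  intro u hu
  have hsub : ∀ z x : EuclideanSpace ℝ (Fin n), ⟪u, x - z⟫ = ⟪u, x⟫ - ⟪u, z⟫ :=
    fun z x => inner_sub_right _ _ _
  obtain ⟨hg1, hg2⟩ := hg_iso u hu
  have vf := variance_min hK_compact hf_supp hf_int hf_prob hf_mom1 hzf u ⟪u, zg⟫
  have vg := variance_min hK_compact hg_supp hg_int hg_prob hg_mom1 hzg u ⟪u, zf⟫
  simp only [hsub] at *
  constructor
  · by_contra! hlt
    have := transfer hK_compact hf_meas hg_meas hf_nonneg hg_nonneg hf_lc hf_supp hf_pos hf_int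
      hf_prob hwarm_gf u ⟪u, zf⟫ (m := 1 / 16) (by norm_num) (by norm_num; linarith)
      (a := 20) (by norm_num)
    norm_num at this
    linarith
  · have := transfer hK_compact hg_meas hf_meas hg_nonneg hf_nonneg hg_lc hg_supp hg_pos hg_int
      hg_prob hwarm_fg u ⟪u, zg⟫ (m := √2) (by positivity) (by norm_num; linarith)
      (a := 1 / 25) (by norm_num)
    have h4 : √2 ^ 4 = (4 : ℝ) := by
      rw [show (4 : ℕ) = 2 * 2 by norm_num, pow_mul, Real.sq_sqrt (by norm_num)]; norm_num
    rw [h4] at this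
    norm_num at this
    linarith
end
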